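/- arXiv:2007.00065 — 2 statements merged into one kernel-verified Lean document; each statement's English description precedes it below -/
import Mathlib

section
/- Let m ≥ 1 and set d(m) := ⌈(442m + 200)/171⌉ (that is, ⌈(8.84m + 4)/3.42⌉). If n ≥ max{m, 1000} and λ = (n, m), then R_λ(x) has no factor of degree d in ℤ[x] for any d with d(m) ≤ d ≤ (n + m − s_λ)/2. -/
open Polynomial Finset

/-- Probabilists' Hermite polynomials over `ℤ`:
`He 0 = 1`, `He 1 = X`, `He (n+1) = X * He n - n * He (n-1)`. -/
noncomputable def He : ℕ → Polynomial ℤ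
  | 0 => 1
  | 1 => Polynomial.X
  | n + 2 => Polynomial.X * He (n + 1) - Polynomial.C ((n : ℤ) + 1) * He n

/-- The Wronskian `Wr[He_{n_1}, …, He_{n_r}]` of the Hermite polynomials indexed by
a degree sequence `ns : Fin r → ℕ`; entry `(i,j)` is the `i`-th derivative of `He (ns j)`. -/
noncomputable def wronskHe {r : ℕ} (ns : Fin r → ℕ) : Polynomial ℤ :=
  Matrix.det (Matrix.of fun i j : Fin r =>
    (fun q : Polynomial ℤ => Polynomial.derivative q)^[(i : ℕ)] (He (ns j)))

/-- `Δ(n_λ) = ∏_{i<j} (n_j - n_i)`. -/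
def vand {r : ℕ} (ns : Fin r → ℕ) : ℤ :=
  ∏ j : Fin r, ∏ i ∈ Finset.Iio j, ((ns j : ℤ) - (ns i : ℤ))

/-- The degree sequence `n_λ` of a partition `λ = (λ_1 ≥ … ≥ λ_r)`,
`n_i = λ_{r+1-i} + (i-1)` (indices shifted to start at `0`). -/
def degSeq {r : ℕ} (lam : Fin r → ℕ) : Fin r → ℕ :=
  fun i => lam i.rev + (i : ℕ)

/-- `d_λ` = (number of odd entries of the degree sequence) − (number of even entries). -/
def dStat {r : ℕ} (ns : Fin r → ℕ) : ℤ :=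
  ((Finset.univ.filter fun i => Odd (ns i)).card : ℤ) -
    ((Finset.univ.filter fun i => Even (ns i)).card : ℤ)

/-- `s_λ = d_λ(d_λ+1)/2`, the size of the 2-core of `λ`. -/
def sStat {r : ℕ} (ns : Fin r → ℕ) : ℕ :=
  (dStat ns * (dStat ns + 1) / 2).toNat

theorem derivative_He_succ (n : ℕ) :
    derivative (He (n + 1)) = C ((n : ℤ) + 1) * He n := by
  induction n using Nat.strong_induction_on with
  | _ n ih =>
    match n with
    | 0 => simp [He]
    | 1 => simp [He]; ring
    | n + 2 =>
      have h1 := ih (n + 1) (by omega)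
      have h0 := ih n (by omega)
      rw [show He (n + 2 + 1) = X * He (n + 1 + 1) - C (((n + 1 : ℕ) : ℤ) + 1) * He (n + 1) from rfl]
      rw [derivative_sub, derivative_mul, derivative_mul, h1, h0]
      rw [show He (n + 2) = X * He (n + 1) - C ((n : ℤ) + 1) * He n from rfl]
      simp only [derivative_X, Nat.cast_add, Nat.cast_one, Nat.cast_ofNat, map_add,
        map_one, map_ofNat, map_natCast]
      simp only [derivative_natCast, derivative_one]
      ring

theorem He_eq_hermite (n : ℕ) : He n = hermite n := by
  induction n using Nat.strong_induction_on with
  | _ n ih =>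
    match n with
    | 0 => simp [He]
    | 1 => simp [He]
    | n + 2 =>
      rw [hermite_succ, ← ih (n + 1) (by omega), derivative_He_succ]
      rfl

theorem coeff_He (N w : ℕ) : (He N).coeff w =
    if Even (N + w) then (-1 : ℤ) ^ ((N - w) / 2) * (Nat.doubleFactorial (N - w - 1) : ℤ) * (Nat.choose N w : ℤ)
    else 0 := by
  rw [He_eq_hermite, coeff_hermite]
 
theorem coeff_He_ne_zero {N w : ℕ} (h : (He N).coeff w ≠ 0) : w ≤ N ∧ (N + w) % 2 = 0 := by
  rw [coeff_He] at h
  split_ifs at h with h1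
  · refine ⟨?_, Nat.even_iff.1 h1⟩
    by_contra h2
    exact h (by rw [Nat.choose_eq_zero_of_lt (by omega)]; simp)
  · exact absurd rfl h

theorem doubleFactorial_odd_mul (n : ℕ) :
    (2 * n - 1).doubleFactorial * (2 ^ n * n.factorial) = (2 * n).factorial := by
  rw [← Nat.doubleFactorial_two_mul]
  cases n with
  | zero => simp
  | succ n =>
    rw [show 2 * (n + 1) = 2 * n + 1 + 1 by ring, Nat.factorial_eq_mul_doubleFactorial, mul_comm]
    rfl

/-- The lowest coefficient of a Hermite polynomial compared with the others. -/
theorem coeff_He_mul_choose (K t ε : ℕ) (hε : ε ≤ 1) (ht : t ≤ K) :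
    ((He (2 * K + ε)).coeff ε).natAbs * K.choose t =
      ((He (2 * K + ε)).coeff (2 * t + ε)).natAbs * (2 * (t + ε) - 1).doubleFactorial := by
  obtain ⟨k, rfl⟩ := Nat.exists_eq_add_of_le ht
  have e1 : ((He (2 * (t + k) + ε)).coeff ε).natAbs =
      (2 * (t + k) - 1).doubleFactorial * (2 * (t + k) + ε).choose ε := by
    rw [coeff_He, if_pos ⟨t + k + ε, by ring⟩]
    simp [Int.natAbs_mul, Int.natAbs_pow]
  have e2 : ((He (2 * (t + k) + ε)).coeff (2 * t + ε)).natAbs =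
      (2 * k - 1).doubleFactorial * (2 * (t + k) + ε).choose (2 * t + ε) := by
    rw [coeff_He, if_pos ⟨2 * t + k + ε, by ring⟩]
    rw [show 2 * (t + k) + ε - (2 * t + ε) = 2 * k by omega]
    simp [Int.natAbs_mul, Int.natAbs_pow]
  rw [e1, e2]
  have c1 := Nat.choose_mul_factorial_mul_factorial (n := 2 * (t + k) + ε) (k := ε) (by omega)
  have c2 := Nat.choose_mul_factorial_mul_factorial (n := 2 * (t + k) + ε) (k := 2 * t + ε) (by omega)
  have c3 := Nat.choose_mul_factorial_mul_factorial (n := t + k) (k := t) (by omega)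
  rw [show 2 * (t + k) + ε - ε = 2 * (t + k) by omega] at c1
  rw [show 2 * (t + k) + ε - (2 * t + ε) = 2 * k by omega] at c2
  rw [show t + k - t = k by omega] at c3
  have d1 := doubleFactorial_odd_mul (t + k)
  have d2 := doubleFactorial_odd_mul k
  have d3 : (2 * (t + ε) - 1).doubleFactorial * (2 ^ t * t.factorial) = (2 * t + ε).factorial := by
    interval_cases ε
    · simpa using doubleFactorial_odd_mul t
    · rw [← Nat.doubleFactorial_two_mul, Nat.factorial_eq_mul_doubleFactorial]
      rfl
  have hε1 : ε.factorial = 1 := by interval_cases ε <;> rfl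
  rw [hε1, mul_one] at c1
  have hpos : 0 < (2 ^ t * t.factorial) * (2 ^ k * k.factorial) * (2 ^ k * k.factorial) := by positivity
  apply Nat.eq_of_mul_eq_mul_right hpos
  have hk : (2 ^ t * t.factorial) * (2 ^ k * k.factorial) * (t + k).choose t =
      2 ^ (t + k) * (t + k).factorial := by rw [← c3, pow_add]; ring
  calc _ = (2 * (t + k) - 1).doubleFactorial * ((2 ^ t * t.factorial) * (2 ^ k * k.factorial) * (t + k).choose t)
        * (2 * (t + k) + ε).choose ε * (2 ^ k * k.factorial) := by ring
    _ = (2 * (t + k) + ε).factorial * (2 ^ k * k.factorial) := by rw [hk, d1, ← c1]; ring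
    _ = ((2 * (t + k) + ε).choose (2 * t + ε) * (2 * t + ε).factorial * (2 * k).factorial)
        * (2 ^ k * k.factorial) := by rw [c2]
    _ = _ := by rw [← d2, ← d3]; ring

theorem exists_last_argmin (S : Finset ℕ) (hS : S.Nonempty) (φ : ℕ → ℕ) :
    ∃ k ∈ S, ∀ i ∈ S, φ k < φ i ∨ (φ k = φ i ∧ i ≤ k) := by
  obtain ⟨a, ha, hmin⟩ := S.exists_min_image φ hS
  obtain ⟨k, hk, hmax⟩ := (S.filter fun i => φ i = φ a).exists_max_image id ⟨a, by simp [ha]⟩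
  rw [Finset.mem_filter] at hk
  refine ⟨k, hk.1, fun i hi => ?_⟩
  rcases (hmin i hi).lt_or_eq with h | h
  · left; omega
  · right
    exact ⟨by omega, hmax i (Finset.mem_filter.2 ⟨hi, h.symm⟩)⟩

/-- A Newton polygon obstruction: if the `p`-adic Newton polygon of `g * h` has all slopes
steeper than `-1 / deg g`, then `g` cannot vanish at `0` modulo `p`. -/
theorem false_of_newton_slope {p V d : ℕ} [Fact p.Prime] {g h : ℤ[X]} (hd : g.natDegree = d)
    (hd0 : 1 ≤ d) (hlead : ¬ (p : ℤ) ∣ g.leadingCoeff) (hg0 : (p : ℤ) ∣ g.coeff 0)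
    (h0 : (g * h).coeff 0 ≠ 0) (hV : ¬ (p : ℤ) ^ (V + 1) ∣ (g * h).coeff 0)
    (hi : ∀ i, 1 ≤ i → (p : ℤ) ^ V ∣ (p : ℤ) ^ ((i - 1) / d) * (g * h).coeff i) : False := by
  have hp : p.Prime := Fact.out
  have hp0 : (p : ℤ) ≠ 0 := by exact_mod_cast hp.ne_zero
  have h00 : g.coeff 0 * h.coeff 0 ≠ 0 := by rwa [mul_coeff_zero] at h0
  have hgc := left_ne_zero_of_mul h00
  have hhc := right_ne_zero_of_mul h00
  obtain ⟨a, ha, hamin⟩ := exists_last_argmin g.support ⟨0, by simpa using hgc⟩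
    (fun i => d * padicValInt p (g.coeff i) + i)
  obtain ⟨b, hb, hbmin⟩ := exists_last_argmin h.support ⟨0, by simpa using hhc⟩
    (fun i => d * padicValInt p (h.coeff i) + i)
  rw [mem_support_iff] at ha hb
  set c := padicValInt p (g.coeff a) + padicValInt p (h.coeff b) with hc
  have hapos : 0 < a := by
    by_contra hcon
    obtain rfl : a = 0 := by omega
    have hdm : d ∈ g.support := by
      rw [← hd]; exact natDegree_mem_support_of_nonzero (by rintro rfl; simp at hgc)
    have hvd : padicValInt p (g.coeff d) = 0 :=
      padicValInt.eq_zero_of_not_dvd (by rw [← hd]; exact hlead)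
    have hv0 : 1 ≤ padicValInt p (g.coeff 0) := by
      have := (padicValInt_dvd_iff (p := p) 1 (g.coeff 0)).1 (by simpa using hg0)
      tauto
    have := hamin d hdm
    simp only [hvd] at this
    have h4 := Nat.mul_le_mul (le_refl d) hv0
    omega
  have hmain : ¬ (p : ℤ) ^ (c + 1) ∣ (g * h).coeff (a + b) := by
    rw [coeff_mul, ← Finset.add_sum_erase _ _ (a := (a, b)) (by simp)]
    intro hdiv
    have hrest : (p : ℤ) ^ (c + 1) ∣ ∑ x ∈ (antidiagonal (a + b)).erase (a, b),
        g.coeff x.1 * h.coeff x.2 := by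
      refine Finset.dvd_sum fun x hx => ?_
      obtain ⟨i, j⟩ := x
      rw [Finset.mem_erase, Finset.HasAntidiagonal.mem_antidiagonal] at hx
      obtain ⟨hne, hsum⟩ := hx
      simp only at hsum ⊢
      by_cases hgi : g.coeff i = 0
      · simp [hgi]
      by_cases hhj : h.coeff j = 0
      · simp [hhj]
      have h1 := hamin i (mem_support_iff.2 hgi)
      have h2 := hbmin j (mem_support_iff.2 hhj)
      have hlt : c < padicValInt p (g.coeff i) + padicValInt p (h.coeff j) := by
        by_contra hcon
        push Not at hcon
        have h3 : d * padicValInt p (g.coeff i) + d * padicValInt p (h.coeff j) ≤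
            d * padicValInt p (g.coeff a) + d * padicValInt p (h.coeff b) := by
          rw [← mul_add, ← mul_add]; exact Nat.mul_le_mul le_rfl hcon
        apply hne
        rw [Prod.mk.injEq]
        omega
      rw [padicValInt_dvd_iff, padicValInt.mul hgi hhj]
      exact Or.inr hlt
    have := (dvd_add_left hrest).1 hdiv
    rw [padicValInt_dvd_iff, padicValInt.mul ha hb] at this
    rcases this with h' | h'
    · exact mul_ne_zero ha hb h'
    · omega
  have hVc : V ≤ (a + b - 1) / d + c := by
    by_contra hcon
    push Not at hcon
    have h1 := hi (a + b) (by omega)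
    have h2 : (p : ℤ) ^ ((a + b - 1) / d + (c + 1)) ∣
        (p : ℤ) ^ ((a + b - 1) / d) * (g * h).coeff (a + b) :=
      (pow_dvd_pow _ (by omega)).trans h1
    rw [pow_add] at h2
    exact hmain ((mul_dvd_mul_iff_left (pow_ne_zero _ hp0)).1 h2)
  have hv0 : padicValInt p (g.coeff 0) + padicValInt p (h.coeff 0) ≤ V := by
    rw [mul_coeff_zero, padicValInt_dvd_iff, padicValInt.mul hgc hhc] at hV
    push Not at hV
    omega
  have h1 := hamin 0 (mem_support_iff.2 hgc)
  have h2 := hbmin 0 (mem_support_iff.2 hhc)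
  have h3 : d * c + (a + b) ≤ d * V := by
    have := Nat.mul_le_mul (le_refl d) hv0
    rw [mul_add] at this
    rw [hc, mul_add]
    omega
  have h4 := Nat.mul_le_mul (le_refl d) hVc
  rw [mul_add] at h4
  have h5 := Nat.mul_div_le (a + b - 1) d
  omega

theorem map_He_prime {p : ℕ} (hp : p.Prime) (hp2 : p ≠ 2) :
    (He p).map (Int.castRingHom (ZMod p)) = X ^ p := by
  have : Fact p.Prime := ⟨hp⟩
  ext w
  rw [coeff_map, coeff_X_pow, coeff_He]
  have hodd : Odd p := hp.odd_of_ne_two hp2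
  rcases lt_trichotomy w p with h | rfl | h
  · rw [if_neg (by omega : ¬ w = p)]
    rcases Nat.eq_zero_or_pos w with rfl | hw
    · rw [if_neg (by simpa using Nat.not_even_iff_odd.2 hodd)]; simp
    · have : ((p.choose w : ℕ) : ZMod p) = 0 :=
        (ZMod.natCast_eq_zero_iff _ _).2 (hp.dvd_choose_self (by omega) h)
      split_ifs
      · simp [this]
      · simp
  · simp
  · rw [if_neg (by omega : ¬ w = p)]
    simp [Nat.choose_eq_zero_of_lt h]

theorem map_He_prime_add {p : ℕ} (hp : p.Prime) (hp2 : p ≠ 2) (j : ℕ) :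
    (He (p + j)).map (Int.castRingHom (ZMod p)) =
      X ^ p * (He j).map (Int.castRingHom (ZMod p)) := by
  have key : ∀ n, (He (n + 2)).map (Int.castRingHom (ZMod p)) =
      X * (He (n + 1)).map (Int.castRingHom (ZMod p)) -
        C ((n : ZMod p) + 1) * (He n).map (Int.castRingHom (ZMod p)) := by
    intro n
    simp [He]
  induction j using Nat.strong_induction_on with
  | _ j ih =>
    match j with
    | 0 => simp [He, map_He_prime hp hp2]
    | 1 =>
      obtain ⟨k, rfl⟩ : ∃ k, p = k + 1 := ⟨p - 1, by have := hp.pos; omega⟩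
      rw [key, map_He_prime hp hp2]
      have : ((k : ZMod (k + 1)) + 1) = 0 := by
        exact_mod_cast CharP.cast_eq_zero (ZMod (k + 1)) (k + 1)
      rw [this]
      simp [He, mul_comm]
    | j + 2 =>
      rw [show p + (j + 2) = (p + j) + 2 by ring, key, key, ih j (by omega),
        show p + j + 1 = p + (j + 1) by ring, ih (j + 1) (by omega)]
      simp
      ring

theorem map_He_mul_add {p : ℕ} (hp : p.Prime) (hp2 : p ≠ 2) (q j : ℕ) :
    (He (p * q + j)).map (Int.castRingHom (ZMod p)) =
      X ^ (p * q) * (He j).map (Int.castRingHom (ZMod p)) := by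
  induction q with
  | zero => simp
  | succ q ih =>
    rw [show p * (q + 1) + j = p + (p * q + j) by ring, map_He_prime_add hp hp2, ih]
    ring

theorem natDegree_He (n : ℕ) : (He n).natDegree = n := by
  rw [He_eq_hermite, natDegree_hermite]

theorem coeff_He_self (n : ℕ) : (He n).coeff n = 1 := by
  rw [He_eq_hermite, coeff_hermite_self]

theorem coeff_He_add_two (N w : ℕ) :
    (((w : ℤ) + 1) * (w + 2)) * (He N).coeff (w + 2) = ((w : ℤ) - N) * (He N).coeff w := by
  have h1 : derivative (He (N + 1)) = He N + X * derivative (He N) - derivative (derivative (He N)) := by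
    rw [show He (N + 1) = X * He N - derivative (He N) by simp only [He_eq_hermite, hermite_succ]]
    simp
  rw [derivative_He_succ] at h1
  have h2 := congrArg (fun f => f.coeff w) h1
  simp only [coeff_C_mul, coeff_sub, coeff_add, coeff_derivative] at h2
  have h3 : (X * derivative (He N)).coeff w = w * (He N).coeff w := by
    cases w with
    | zero => simp
    | succ w => rw [coeff_X_mul, coeff_derivative]; push_cast; ring
  rw [h3] at h2
  push_cast at h2
  linear_combination h2

/-- The Wronskian of two Hermite polynomials. -/
noncomputable def pairWr (m N : ℕ) : ℤ[X] := He m * derivative (He N) - derivative (He m) * He N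

theorem natDegree_derivative_He_le (n : ℕ) : (derivative (He n)).natDegree ≤ n - 1 := by
  have := natDegree_derivative_le (He n)
  rwa [natDegree_He] at this

theorem natDegree_pairWr_le {m N : ℕ} (hm : 1 ≤ m) (hN : 1 ≤ N) :
    (pairWr m N).natDegree ≤ m + N - 1 := by
  rw [pairWr]
  have h1 := natDegree_derivative_He_le N
  have h2 := natDegree_derivative_He_le m
  have h3 := natDegree_mul_le (p := He m) (q := derivative (He N))
  have h4 := natDegree_mul_le (p := derivative (He m)) (q := He N)
  rw [natDegree_He] at h3 h4
  exact (natDegree_sub_le _ _).trans (max_le (by omega) (by omega))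

theorem coeff_pairWr_top {m N : ℕ} (hm : 1 ≤ m) (hN : 1 ≤ N) :
    (pairWr m N).coeff (m + N - 1) = (N : ℤ) - m := by
  obtain ⟨a, rfl⟩ : ∃ a, m = a + 1 := ⟨m - 1, by omega⟩
  obtain ⟨b, rfl⟩ : ∃ b, N = b + 1 := ⟨N - 1, by omega⟩
  rw [pairWr, coeff_sub]
  have e1 : (He (a + 1) * derivative (He (b + 1))).coeff (a + 1 + (b + 1) - 1) = (b : ℤ) + 1 := by
    rw [show a + 1 + (b + 1) - 1 = (a + 1) + b by omega,
      coeff_mul_add_eq_of_natDegree_le (natDegree_He _).le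
        (show _ ≤ b from natDegree_derivative_He_le _),
      coeff_derivative, coeff_He_self, coeff_He_self]
    ring
  have e2 : (derivative (He (a + 1)) * He (b + 1)).coeff (a + 1 + (b + 1) - 1) = (a : ℤ) + 1 := by
    rw [show a + 1 + (b + 1) - 1 = a + (b + 1) by omega,
      coeff_mul_add_eq_of_natDegree_le (show _ ≤ a from natDegree_derivative_He_le _)
        (natDegree_He _).le,
      coeff_derivative, coeff_He_self, coeff_He_self]
    ring
  rw [e1, e2]; push_cast; ring

theorem map_pairWr {p : ℕ} (hp : p.Prime) (hp2 : p ≠ 2) (m q r : ℕ) :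
    (pairWr m (p * q + r)).map (Int.castRingHom (ZMod p)) =
      X ^ (p * q) * ((pairWr m r).map (Int.castRingHom (ZMod p))) := by
  have hder : derivative ((X : (ZMod p)[X]) ^ (p * q)) = 0 := by
    rw [derivative_X_pow]; simp
  simp only [pairWr, Polynomial.map_sub, Polynomial.map_mul, ← derivative_map,
    map_He_mul_add hp hp2, derivative_mul, hder]
  ring

/-- Coefficients of the Wronskian are combinations of the coefficients of `He N` of
controlled index. -/
theorem dvd_mul_coeff_pairWr {m N j : ℕ} {c e : ℤ}
    (H : ∀ w, w ≤ j + 1 - m % 2 → w ≤ N → w % 2 = N % 2 → e ∣ c * (He N).coeff w) :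
    e ∣ c * (pairWr m N).coeff j := by
  have H' : ∀ u w, (He m).coeff u ≠ 0 → u + w ≤ j + 1 → e ∣ c * (He N).coeff w := by
    intro u w hu huw
    by_cases hw : (He N).coeff w = 0
    · simp [hw]
    have h1 := coeff_He_ne_zero hu
    have h2 := coeff_He_ne_zero hw
    exact H w (by omega) h2.1 (by omega)
  rw [pairWr, coeff_sub, mul_sub, coeff_mul, coeff_mul, Finset.mul_sum, Finset.mul_sum]
  refine dvd_sub (Finset.dvd_sum fun x hx => ?_) (Finset.dvd_sum fun x hx => ?_)
  · rw [Finset.HasAntidiagonal.mem_antidiagonal] at hx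
    rw [coeff_derivative]
    by_cases hu : (He m).coeff x.1 = 0
    · simp [hu]
    have := H' x.1 (x.2 + 1) hu (by omega)
    rw [show c * ((He m).coeff x.1 * ((He N).coeff (x.2 + 1) * (x.2 + 1))) =
      (c * (He N).coeff (x.2 + 1)) * ((He m).coeff x.1 * (x.2 + 1)) by ring]
    exact this.mul_right _
  · rw [Finset.HasAntidiagonal.mem_antidiagonal] at hx
    rw [coeff_derivative]
    by_cases hu : (He m).coeff (x.1 + 1) = 0
    · simp [hu]
    have := H' (x.1 + 1) x.2 hu (by omega)
    rw [show c * ((He m).coeff (x.1 + 1) * (x.1 + 1) * (He N).coeff x.2) =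
      (c * (He N).coeff x.2) * ((He m).coeff (x.1 + 1) * (x.1 + 1)) by ring]
    exact this.mul_right _

theorem coeff_He_one_eq_zero {n : ℕ} (h : n % 2 = 0) : (He n).coeff 1 = 0 := by
  by_contra hc
  have := coeff_He_ne_zero hc
  omega

theorem coeff_He_zero_eq_zero {n : ℕ} (h : n % 2 = 1) : (He n).coeff 0 = 0 := by
  by_contra hc
  have := coeff_He_ne_zero hc
  omega

/-- The order at `0` of the Wronskian of `He m` and `He N`. -/
def pairOrder (m N : ℕ) : ℕ :=
  if m % 2 = 1 ∧ N % 2 = 1 then 3 else if m % 2 = 0 ∧ N % 2 = 0 then 1 else 0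

theorem coeff_pairWr_order {m N : ℕ} :
    ∃ k : ℤ, (k = 1 ∨ k = N - m) ∧ ∃ l : ℤ, l * (pairWr m N).coeff (pairOrder m N) =
      k * ((He m).coeff (m % 2) * (He N).coeff (N % 2)) := by
  have a0 := coeff_He_add_two m 0
  have a1 := coeff_He_add_two m 1
  have b0 := coeff_He_add_two N 0
  have b1 := coeff_He_add_two N 1
  rcases Nat.mod_two_eq_zero_or_one m with h | h <;> rcases Nat.mod_two_eq_zero_or_one N with h' | h'
  · refine ⟨N - m, Or.inr rfl, -1, ?_⟩
    have h1 := coeff_He_one_eq_zero h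
    have h2 := coeff_He_one_eq_zero h'
    simp [pairOrder, h, h', pairWr, coeff_mul, Finset.Nat.antidiagonal_succ, coeff_derivative, h1, h2] at *
    linear_combination (He N).coeff 0 * a0 - (He m).coeff 0 * b0
  · refine ⟨1, Or.inl rfl, 1, ?_⟩
    have h1 := coeff_He_one_eq_zero h
    simp [pairOrder, h, h', pairWr, coeff_mul, coeff_derivative, h1]
  · refine ⟨1, Or.inl rfl, -1, ?_⟩
    have h1 := coeff_He_one_eq_zero h'
    simp [pairOrder, h, h', pairWr, coeff_mul, coeff_derivative, h1]
  · refine ⟨N - m, Or.inr rfl, -3, ?_⟩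
    have h1 := coeff_He_zero_eq_zero h
    have h2 := coeff_He_zero_eq_zero h'
    have h3 := coeff_He_add_two m 2
    have h4 := coeff_He_add_two N 2
    have h5 : (He m).coeff 2 = 0 := by
      by_contra hc
      have := coeff_He_ne_zero hc
      omega
    have h6 : (He N).coeff 2 = 0 := by
      by_contra hc
      have := coeff_He_ne_zero hc
      omega
    simp [pairOrder, h, h', pairWr, coeff_mul, Finset.Nat.antidiagonal_succ, coeff_derivative, h1, h2, h5, h6] at *
    linear_combination (He N).coeff 1 * a1 - (He m).coeff 1 * b1

theorem not_dvd_coeff_He_low {p m : ℕ} (hp : p.Prime) (hpm : m < p) :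
    ¬ (p : ℤ) ∣ (He m).coeff (m % 2) := by
  have hdf : ∀ k < p, ¬ p ∣ k.doubleFactorial := fun k hk h => by
    have h1 : p ∣ k.factorial := by
      cases k with
      | zero => simpa using h
      | succ k => rw [Nat.factorial_eq_mul_doubleFactorial]; exact h.mul_right _
    exact absurd ((hp.dvd_factorial).1 h1) (by omega)
  rw [Int.natCast_dvd, coeff_He, if_pos (by rw [Nat.even_iff]; omega)]
  simp only [Int.natAbs_mul, Int.natAbs_pow, Int.natAbs_neg, Int.natAbs_one, one_pow, one_mul,
    Int.natAbs_natCast]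
  intro h
  rcases (hp.dvd_mul).1 h with h | h
  · exact hdf _ (by omega) h
  · rcases Nat.mod_two_eq_zero_or_one m with h' | h'
    · rw [h', Nat.choose_zero_right] at h
      exact hp.one_lt.ne' (Nat.dvd_one.1 h)
    · rw [h', Nat.choose_one_right] at h
      exact absurd (Nat.le_of_dvd (by omega) h) (by omega)

/-- If `p` divides no leading data and `N` modulo `p` is small, then no factor of degree `d` of
the remainder polynomial exists, provided the `p`-adic Newton polygon of `He N` is flat. -/
theorem false_of_flat {m N d p : ℕ} (hm : 1 ≤ m) (hmN : m < N) (hp : p.Prime)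
    (hp5 : 5 ≤ p) (hpm : m < p) (hNm : ¬ (p : ℤ) ∣ (N : ℤ) - m) (hr : N % p + m ≤ d)
    {HeL RL g : ℤ[X]} (hA : C ((N : ℤ) - m) * HeL = pairWr m N)
    (hR : HeL = X ^ pairOrder m N * RL) (hR0 : RL.coeff 0 ≠ 0)
    (H : ∀ i, 1 ≤ i → ∀ w, w ≤ i + pairOrder m N + 1 - m % 2 → w ≤ N → w % 2 = N % 2 →
      (p : ℤ) ^ padicValInt p ((He N).coeff (N % 2)) ∣ (p : ℤ) ^ ((i - 1) / d) * (He N).coeff w)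
    (hgd : g.natDegree = d) (hg : g ∣ RL) : False := by
  have : Fact p.Prime := ⟨hp⟩
  obtain ⟨h, rfl⟩ := hg
  have hpZ : Prime (p : ℤ) := Nat.prime_iff_prime_int.1 hp
  have hNm0 : (N : ℤ) - m ≠ 0 := by omega
  have htop : HeL.coeff (m + N - 1) = 1 := by
    have := coeff_pairWr_top hm (by omega : 1 ≤ N)
    rw [← hA, coeff_C_mul] at this
    exact mul_left_cancel₀ hNm0 (by rw [this, mul_one])
  have hdeg : HeL.natDegree ≤ m + N - 1 := by
    have := natDegree_pairWr_le hm (by omega : 1 ≤ N)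
    rwa [← hA, natDegree_C_mul hNm0] at this
  have hlc : HeL.leadingCoeff = 1 := by
    have : HeL.natDegree = m + N - 1 :=
      le_antisymm hdeg (le_natDegree_of_ne_zero (by rw [htop]; norm_num))
    rw [leadingCoeff, this, htop]
  have hgl : ¬ (p : ℤ) ∣ g.leadingCoeff := by
    intro hdiv
    rw [hR, leadingCoeff_mul, leadingCoeff_mul] at hlc
    have : (p : ℤ) ∣ 1 := by
      rw [← hlc]; exact (hdiv.mul_right _).mul_left _
    exact hpZ.not_isUnit (isUnit_of_dvd_one this)
  have hr' : (m + N % p - 1) < d := by omega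
  have hg0 : (p : ℤ) ∣ g.coeff 0 := by
    by_contra hcon
    set φ := Int.castRingHom (ZMod p)
    have hmap : (C (φ ((N : ℤ) - m)) * X ^ pairOrder m N * h.map φ) * g.map φ =
        X ^ (p * (N / p)) * (pairWr m (N % p)).map φ := by
      rw [← map_pairWr hp (by omega), Nat.div_add_mod, ← hA, hR]
      simp only [Polynomial.map_mul, Polynomial.map_pow, map_X, map_C]
      ring
    have hcast : ∀ z : ℤ, ¬ (p : ℤ) ∣ z → φ z ≠ 0 := fun z hz h0 =>
      hz ((ZMod.intCast_zmod_eq_zero_iff_dvd z p).1 (by simpa [φ] using h0))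
    have hcop : IsCoprime (X : (ZMod p)[X]) (g.map φ) := by
      rw [irreducible_X.coprime_iff_not_dvd, X_dvd_iff, coeff_map]
      exact hcast _ hcon
    have hdvd : g.map φ ∣ (pairWr m (N % p)).map φ :=
      (hcop.pow_left (m := p * (N / p))).symm.dvd_of_dvd_mul_left (Dvd.intro_left _ hmap)
    have hne : (pairWr m (N % p)).map φ ≠ 0 := by
      intro h0
      rw [h0, mul_zero] at hmap
      have h1 : (C ((N : ℤ) - m) * HeL).map φ = 0 := by
        rw [hR, ← hmap]
        simp only [Polynomial.map_mul, Polynomial.map_pow, map_X, map_C]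
        ring
      have h2 := congrArg (fun f => f.coeff (m + N - 1)) h1
      simp only [coeff_map, coeff_C_mul, htop, mul_one, coeff_zero] at h2
      exact hcast _ hNm h2
    have h1 := natDegree_le_of_dvd hdvd hne
    have h2 : (g.map φ).natDegree = d := by
      rw [natDegree_map_of_leadingCoeff_ne_zero _ (hcast _ hgl), hgd]
    have h3 : (pairWr m (N % p)).natDegree ≤ m + N % p - 1 := by
      rcases Nat.eq_zero_or_pos (N % p) with h0 | h0
      · have : (pairWr m 0).natDegree ≤ m - 1 := by
          simpa [pairWr, He] using natDegree_derivative_He_le m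
        rw [h0]; omega
      · exact natDegree_pairWr_le hm h0
    have h4 := natDegree_map_le (f := φ) (p := pairWr m (N % p))
    omega
  have hcoeff : ∀ i, (pairWr m N).coeff (i + pairOrder m N) = ((N : ℤ) - m) * (g * h).coeff i := by
    intro i
    rw [← hA, hR, coeff_C_mul, coeff_X_pow_mul]
  have hcopN : ∀ k, IsCoprime ((p : ℤ) ^ k) ((N : ℤ) - m) := fun k =>
    (hpZ.irreducible.coprime_iff_not_dvd.2 hNm).pow_left
  refine false_of_newton_slope (V := padicValInt p ((He N).coeff (N % 2))) hgd (by omega) hgl hg0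
    hR0 ?_ ?_
  · intro hdiv
    obtain ⟨k, hk, l, hl⟩ := coeff_pairWr_order (m := m) (N := N)
    have h0 := hcoeff 0
    rw [zero_add] at h0
    have h1 : (p : ℤ) ^ (padicValInt p ((He N).coeff (N % 2)) + 1) ∣
        (k * (He m).coeff (m % 2)) * (He N).coeff (N % 2) := by
      rw [mul_assoc, ← hl, h0]
      exact (hdiv.mul_left _).mul_left _
    have hpk : ¬ (p : ℤ) ∣ k * (He m).coeff (m % 2) := by
      intro h
      rcases hpZ.dvd_or_dvd h with h | h
      · rcases hk with rfl | rfl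
        · exact hpZ.not_isUnit (isUnit_of_dvd_one h)
        · exact hNm h
      · exact not_dvd_coeff_He_low hp hpm h
    have h2 := ((hpZ.irreducible.coprime_iff_not_dvd.2 hpk).pow_left).dvd_of_dvd_mul_left h1
    rw [padicValInt_dvd_iff] at h2
    rcases h2 with h2 | h2
    · rw [coeff_He, if_pos (by rw [Nat.even_iff]; omega)] at h2
      have hc : N.choose (N % 2) ≠ 0 := (Nat.choose_pos (by omega)).ne'
      have hdf := (Nat.doubleFactorial_pos (N - N % 2 - 1)).ne'
      simp [hc, hdf] at h2
    · omega
  · intro i hi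
    have h1 : (p : ℤ) ^ padicValInt p ((He N).coeff (N % 2)) ∣
        (p : ℤ) ^ ((i - 1) / d) * (pairWr m N).coeff (i + pairOrder m N) :=
      dvd_mul_coeff_pairWr fun w hw hwN hpar => H i hi w hw hwN hpar
    rw [hcoeff, mul_left_comm] at h1
    exact (hcopN _).dvd_of_dvd_mul_left h1

theorem padicValNat_factorial_eq (p : ℕ) [Fact p.Prime] (n : ℕ) :
    padicValNat p n.factorial = n / p + padicValNat p (n / p).factorial := by
  rw [← padicValNat_mul_div_factorial (p := p) n, padicValNat_factorial_mul, add_comm]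

theorem padicValNat_two_pow {p : ℕ} [Fact p.Prime] (hp2 : p ≠ 2) (n : ℕ) :
    padicValNat p (2 ^ n) = 0 := by
  apply padicValNat.eq_zero_of_not_dvd
  intro h
  have hp : p.Prime := Fact.out
  exact hp2 ((Nat.prime_dvd_prime_iff_eq hp Nat.prime_two).1 (hp.dvd_of_dvd_pow h))

theorem padicValNat_doubleFactorial_even {p : ℕ} [Fact p.Prime] (hp2 : p ≠ 2) (n : ℕ) :
    padicValNat p (2 * n).factorial =
      padicValNat p (2 * n - 1).doubleFactorial + padicValNat p n.factorial := by
  rw [← doubleFactorial_odd_mul, padicValNat.mul (Nat.doubleFactorial_pos _).ne' (by positivity),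
    padicValNat.mul (by positivity) (by positivity), padicValNat_two_pow hp2, zero_add]

theorem padicValNat_doubleFactorial_odd {p : ℕ} [Fact p.Prime] (hp2 : p ≠ 2) (n : ℕ) :
    padicValNat p (2 * n + 1).factorial =
      padicValNat p (2 * n + 1).doubleFactorial + padicValNat p n.factorial := by
  rw [Nat.factorial_eq_mul_doubleFactorial, Nat.doubleFactorial_two_mul,
    padicValNat.mul (Nat.doubleFactorial_pos _).ne' (by positivity),
    padicValNat.mul (by positivity) (by positivity), padicValNat_two_pow hp2, zero_add]

/-- Legendre's recursion for odd double factorials: `k` is the number of odd multiples of `p`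
below `2 * n`. -/
theorem padicValNat_doubleFactorial_rec {p : ℕ} [Fact p.Prime] (hp2 : p ≠ 2) (n : ℕ) :
    ∃ k, p * (2 * k) ≤ 2 * n + p - 1 ∧ padicValNat p (2 * n - 1).doubleFactorial =
      k + padicValNat p (2 * k - 1).doubleFactorial := by
  have h1 := padicValNat_doubleFactorial_even hp2 n
  have h2 := padicValNat_factorial_eq p n
  have h3 := padicValNat_factorial_eq p (2 * n)
  have hp : p.Prime := Fact.out
  set z := n / p with hz
  have hpz := Nat.div_add_mod n p
  have hlt := Nat.mod_lt n hp.pos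
  rw [← hz] at hpz
  by_cases hc : 2 * (n % p) < p
  · have hy : 2 * n / p = 2 * z := by
      rw [show 2 * n = 2 * (n % p) + p * (2 * z) by rw [mul_left_comm, ← mul_add]; omega,
        Nat.add_mul_div_left _ _ hp.pos, Nat.div_eq_of_lt hc, zero_add]
    have h4 := padicValNat_doubleFactorial_even hp2 z
    rw [hy] at h3
    refine ⟨z, ?_, by omega⟩
    rw [mul_left_comm]
    have := hp.pos
    omega
  · have hne : 2 * (n % p) ≠ p := by
      intro h
      rcases hp.eq_two_or_odd with h' | h' <;> omega
    have hy : 2 * n / p = 2 * z + 1 := by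
      rw [show 2 * n = (2 * (n % p) - p) + p * (2 * z + 1) by
        rw [mul_add, mul_left_comm]; omega,
        Nat.add_mul_div_left _ _ hp.pos, Nat.div_eq_of_lt (by omega), zero_add]
    have h4 := padicValNat_doubleFactorial_odd hp2 z
    rw [hy] at h3
    refine ⟨z + 1, ?_, ?_⟩
    · rw [mul_left_comm, mul_add]
      omega
    · rw [show 2 * (z + 1) - 1 = 2 * z + 1 by omega]
      omega

theorem mul_padicValNat_doubleFactorial_le {p : ℕ} [Fact p.Prime] (hp5 : 5 ≤ p) (n : ℕ) :
    p * padicValNat p (2 * n - 1).doubleFactorial ≤ 2 * n - 1 := by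
  induction n using Nat.strong_induction_on with
  | _ n ih =>
    rcases Nat.eq_zero_or_pos n with rfl | hn
    · simp
    obtain ⟨k, hk, he⟩ := padicValNat_doubleFactorial_rec (p := p) (by omega) n
    rw [he, mul_add]
    rw [mul_left_comm] at hk
    have h7 : 5 * k ≤ p * k := Nat.mul_le_mul hp5 le_rfl
    rcases lt_trichotomy k 1 with h | rfl | h
    · obtain rfl : k = 0 := by omega
      simp
    · simp
      omega
    · have h8 : p * 2 ≤ p * k := Nat.mul_le_mul le_rfl h
      have h5 := ih k (by omega)
      have h9 : (p - 2) * 2 ≤ (p - 2) * k := Nat.mul_le_mul le_rfl h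
      rw [Nat.sub_mul, Nat.sub_mul] at h9
      omega

theorem pow_dvd_pow_padicValNat_mul {p V o x : ℕ} [Fact p.Prime] (ho0 : o ≠ 0)
    (h : p ^ V ∣ o * x) : p ^ V ∣ p ^ padicValNat p o * x := by
  have hp : p.Prime := Fact.out
  obtain ⟨c, hc, hoc, hcdef⟩ := Nat.exists_eq_pow_mul_and_not_dvd ho0 p hp.one_lt.ne'
  have hcv : padicValNat p o = c := by
    have hc0 : hc ≠ 0 := by rintro rfl; simp at hoc
    rw [hcdef, padicValNat.mul (pow_ne_zero _ hp.ne_zero) hc0, padicValNat.prime_pow,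
      padicValNat.eq_zero_of_not_dvd hoc, add_zero]
  rw [hcv]
  rw [hcdef, mul_right_comm, mul_comm] at h
  exact (((hp.coprime_iff_not_dvd).2 hoc).pow_left V).dvd_of_dvd_mul_left h

theorem pow_dvd_pow_mul_coeff_He {p : ℕ} [Fact p.Prime] {N w : ℕ} (hw : w ≤ N)
    (hpar : w % 2 = N % 2) {V : ℕ} (hV : (p : ℤ) ^ V ∣ (He N).coeff (N % 2)) :
    (p : ℤ) ^ V ∣
      (p : ℤ) ^ padicValNat p (2 * ((w + 1) / 2) - 1).doubleFactorial * (He N).coeff w := by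
  have key := coeff_He_mul_choose (N / 2) (w / 2) (N % 2) (by omega) (by omega)
  rw [Nat.div_add_mod, show 2 * (w / 2) + N % 2 = w by omega,
    show w / 2 + N % 2 = (w + 1) / 2 by omega] at key
  have h1 : p ^ V ∣
      (2 * ((w + 1) / 2) - 1).doubleFactorial * ((He N).coeff w).natAbs := by
    rw [mul_comm, ← key]
    have := Int.natAbs_dvd_natAbs.2 hV
    rw [Int.natAbs_pow, Int.natAbs_natCast] at this
    exact this.mul_right _
  have := Int.natCast_dvd_natCast.2
    (pow_dvd_pow_padicValNat_mul (Nat.doubleFactorial_pos _).ne' h1)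
  rw [← Int.dvd_natAbs]
  simpa [Int.natAbs_mul, Int.natAbs_pow] using this

theorem false_of_prime {m N d p : ℕ} (hm : 1 ≤ m) (hmN : m < N) (hp : p.Prime) (hd : 1 ≤ d)
    (hp5 : 5 ≤ p) (hpm : m < p) (hpd : d + 4 ≤ p ∨ (d ≤ p ∧ m % 2 = 1 ∧ N % 2 = 0))
    (hNm : ¬ (p : ℤ) ∣ (N : ℤ) - m) (hr : N % p + m ≤ d)
    {HeL RL g : ℤ[X]} (hA : C ((N : ℤ) - m) * HeL = pairWr m N)
    (hR : HeL = X ^ pairOrder m N * RL) (hR0 : RL.coeff 0 ≠ 0)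
    (hgd : g.natDegree = d) (hg : g ∣ RL) : False := by
  have : Fact p.Prime := ⟨hp⟩
  refine false_of_flat hm hmN hp hp5 hpm hNm hr hA hR hR0 (fun i hi w hw hwN hpar => ?_) hgd hg
  have h1 := pow_dvd_pow_mul_coeff_He (p := p) hwN hpar (padicValInt_dvd _)
  refine h1.trans (mul_dvd_mul_right (pow_dvd_pow _ ?_) _)
  have h2 := mul_padicValNat_doubleFactorial_le hp5 ((w + 1) / 2)
  set e := padicValNat p (2 * ((w + 1) / 2) - 1).doubleFactorial
  rw [Nat.le_div_iff_mul_le (by omega)]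
  rcases Nat.eq_zero_or_pos e with h0 | h0
  · simp [h0]
  rcases hpd with hpd | ⟨hpd, hm1, hN0⟩
  · have h3 : e * (d + 4) ≤ p * e := by rw [mul_comm]; exact Nat.mul_le_mul hpd le_rfl
    rw [mul_add] at h3
    unfold pairOrder at hw
    split_ifs at hw <;> omega
  · have h3 : e * d ≤ p * e := by rw [mul_comm]; exact Nat.mul_le_mul hpd le_rfl
    unfold pairOrder at hw
    split_ifs at hw <;> omega

theorem false_of_prime_of_dvd_sub_three {N d p : ℕ} (hN : 3 < N) (hodd : N % 2 = 1)
    (hp : p.Prime) (hp5 : 5 ≤ p) (hd4 : 4 ≤ d) (hd5 : d ≤ 5) (hpN : p ∣ N - 3)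
    {HeL RL g : ℤ[X]} (hA : C ((N : ℤ) - 1) * HeL = pairWr 1 N)
    (hR : HeL = X ^ pairOrder 1 N * RL) (hR0 : RL.coeff 0 ≠ 0)
    (hgd : g.natDegree = d) (hg : g ∣ RL) : False := by
  have : Fact p.Prime := ⟨hp⟩
  obtain ⟨q, hq⟩ := hpN
  have hmod : N % p = 3 := by
    rw [show N = 3 + p * q by omega, Nat.add_mul_mod_self_left, Nat.mod_eq_of_lt (by omega)]
  have hNm : ¬ (p : ℤ) ∣ (N : ℤ) - 1 := by
    intro h
    have h1 : (p : ℤ) ∣ 2 := by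
      have h2 : (p : ℤ) ∣ (N : ℤ) - 3 := ⟨q, by rw [← Nat.cast_mul, ← hq]; omega⟩
      have := dvd_sub h h2
      ring_nf at this
      exact this
    have := Int.le_of_dvd (by norm_num) h1
    omega
  refine false_of_flat le_rfl (by omega) hp hp5 (by omega) hNm (by omega) (by exact_mod_cast hA)
    hR hR0 (fun i hi w hw hwN hpar => ?_) hgd hg
  have hord : pairOrder 1 N = 3 := by simp [pairOrder, hodd]
  rw [hord] at hw
  have hwodd : w % 2 = 1 := by omega
  rw [hodd]
  obtain ⟨t, rfl⟩ : ∃ t, w = 2 * t + 1 := ⟨w / 2, by omega⟩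
  obtain ⟨K, rfl⟩ : ∃ K, N = 2 * K + 1 := ⟨N / 2, by omega⟩
  by_cases hsmall : 2 ≤ t ∧ t < p
  · obtain ⟨ht2, htp⟩ := hsmall
    have hdK : p ∣ K - 1 := by
      have h1 : p ∣ 2 * (K - 1) := ⟨q, by omega⟩
      exact (((Nat.coprime_primes hp Nat.prime_two).2 (by omega)).dvd_of_dvd_mul_left h1)
    have hdc : p ∣ K.choose t := by
      have h1 : p ∣ t.factorial * K.choose t := by
        rw [← Nat.descFactorial_eq_factorial_mul_choose]
        refine dvd_trans ?_ (Dvd.intro_left _ (Nat.descFactorial_mul_descFactorial ht2))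
        simp only [Nat.descFactorial]
        exact hdK.mul_right _
      rcases (hp.dvd_mul).1 h1 with h | h
      · exact absurd ((hp.dvd_factorial).1 h) (by omega)
      · exact h
    have key := coeff_He_mul_choose K t 1 le_rfl (by omega)
    have h1 : p ^ (padicValInt p ((He (2 * K + 1)).coeff 1) + 1) ∣
        (2 * (t + 1) - 1).doubleFactorial * ((He (2 * K + 1)).coeff (2 * t + 1)).natAbs := by
      rw [mul_comm (Nat.doubleFactorial _), ← key, pow_succ]
      have := Int.natAbs_dvd_natAbs.2 (padicValInt_dvd (p := p) ((He (2 * K + 1)).coeff 1))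
      rw [Int.natAbs_pow, Int.natAbs_natCast] at this
      exact mul_dvd_mul this hdc
    have h2 := pow_dvd_pow_padicValNat_mul (Nat.doubleFactorial_pos _).ne' h1
    have h3 := mul_padicValNat_doubleFactorial_le hp5 (t + 1)
    have h4 : padicValNat p (2 * (t + 1) - 1).doubleFactorial ≤ 1 := by
      by_contra hcon
      have := Nat.mul_le_mul (le_refl p) (not_le.1 hcon)
      omega
    have h5 := h2.trans (mul_dvd_mul_right (pow_dvd_pow p h4) _)
    rw [pow_one, pow_succ', Nat.mul_dvd_mul_iff_left hp.pos] at h5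
    refine Dvd.dvd.mul_left ?_ _
    rw [← Int.dvd_natAbs]
    exact_mod_cast h5
  · have h1 := pow_dvd_pow_mul_coeff_He (p := p) hwN hpar (padicValInt_dvd _)
    rw [hodd] at h1
    refine h1.trans (mul_dvd_mul_right (pow_dvd_pow _ ?_) _)
    rw [show 2 * ((2 * t + 1 + 1) / 2) - 1 = 2 * (t + 1) - 1 by omega,
      Nat.le_div_iff_mul_le (by omega)]
    have h3 := mul_padicValNat_doubleFactorial_le hp5 (t + 1)
    obtain ⟨k, hk, he⟩ := padicValNat_doubleFactorial_rec (p := p) (by omega) (t + 1)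
    have h4 := mul_padicValNat_doubleFactorial_le hp5 k
    set e := padicValNat p (2 * (t + 1) - 1).doubleFactorial
    set e' := padicValNat p (2 * k - 1).doubleFactorial
    refine (Nat.mul_le_mul_left e hd5).trans ?_
    have hp6 : p ≠ 6 := by rintro rfl; norm_num at hp
    by_cases ht : t < 2
    · have : e = 0 := by
        by_contra h0
        have := Nat.mul_le_mul hp5 (Nat.one_le_iff_ne_zero.2 h0)
        omega
      omega
    rcases Nat.lt_or_ge p 7 with h7 | h7
    · obtain rfl : p = 5 := by omega
      rcases (by omega : k = 0 ∨ k = 1 ∨ k = 2 ∨ k = 3 ∨ 4 ≤ k) with h | h | h | h | h <;> omega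
    · have := Nat.mul_le_mul h7 (le_refl e)
      omega

theorem exists_eq_two_pow_mul_three_pow {n : ℕ} (hn : n ≠ 0)
    (h : ∀ p, p.Prime → p ∣ n → p < 5) : ∃ a b, n = 2 ^ a * 3 ^ b := by
  obtain ⟨a, k, hk, rfl⟩ := Nat.exists_eq_pow_mul_and_not_dvd hn 2 (by norm_num)
  have hk0 : k ≠ 0 := by rintro rfl; simp at hn
  obtain ⟨b, l, hl, rfl⟩ := Nat.exists_eq_pow_mul_and_not_dvd hk0 3 (by norm_num)
  refine ⟨a, b, ?_⟩
  suffices l = 1 by rw [this, mul_one]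
  by_contra h1
  obtain ⟨p, hp, hpl⟩ := Nat.exists_prime_and_dvd h1
  have h5 := h p hp ((hpl.mul_left _).mul_left _)
  have h2 := hp.two_le
  interval_cases p
  · exact hk (hpl.mul_left _)
  · exact hl hpl
  · norm_num at hp

theorem exists_eq_three_pow_mul_five_pow_mul_seven_pow {n : ℕ} (hn : n % 2 = 1)
    (h : ∀ p, p.Prime → p ∣ n → p < 11) : ∃ a b c, n = 3 ^ a * 5 ^ b * 7 ^ c := by
  obtain ⟨a, k, hk, rfl⟩ := Nat.exists_eq_pow_mul_and_not_dvd (by omega : n ≠ 0) 3 (by norm_num)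
  have hk0 : k ≠ 0 := by rintro rfl; simp at hn
  obtain ⟨b, l, hl, rfl⟩ := Nat.exists_eq_pow_mul_and_not_dvd hk0 5 (by norm_num)
  have hl0 : l ≠ 0 := by rintro rfl; simp at hn
  obtain ⟨c, j, hj, rfl⟩ := Nat.exists_eq_pow_mul_and_not_dvd hl0 7 (by norm_num)
  refine ⟨a, b, c, ?_⟩
  suffices j = 1 by rw [this]; ring
  by_contra h1
  obtain ⟨p, hp, hpj⟩ := Nat.exists_prime_and_dvd h1
  have hpn := ((hpj.mul_left (7 ^ c)).mul_left (5 ^ b)).mul_left (3 ^ a)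
  have h11 := h p hp hpn
  have h2 := hp.two_le
  interval_cases p
  · omega
  · exact hk ((hpj.mul_left _).mul_left _)
  · norm_num at hp
  · exact hl (hpj.mul_left _)
  · norm_num at hp
  · exact hj hpj
  all_goals norm_num at hp

/-- Lifting the exponent bounds the powers of `2` and `3` dividing `q ^ n - 1`. -/
theorem two_pow_le_of_dvd_pow_sub_one {q n a : ℕ} (hq : q % 2 = 1) (hq1 : 1 < q) (hn : 0 < n)
    (h : 2 ^ a ∣ q ^ n - 1) : 2 ^ a ≤ (q ^ 2 - 1) * n := by
  have h1 : 2 ^ a ∣ q ^ (n * 2) - 1 := h.trans (by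
    rw [pow_mul]; simpa using Nat.sub_dvd_pow_sub_pow (q ^ n) 1 2)
  have hne : q ^ (n * 2) - 1 ≠ 0 := by
    have := Nat.one_lt_pow (by omega : n * 2 ≠ 0) hq1
    omega
  have h2 := (padicValNat_dvd_iff_le hne).1 h1
  have h3 := padicValNat.pow_two_sub_pow (x := q) (y := 1) hq1 (by omega) (by omega)
    (n := n * 2) (by omega) (by simp)
  rw [one_pow, padicValNat.mul (by omega) (by norm_num)] at h3
  have h4 : (q ^ 2 - 1) * n = (q + 1) * (q - 1) * n := by
    rw [← Nat.sq_sub_sq]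
  have h6 : 0 < (q + 1) * (q - 1) * n := by
    exact Nat.mul_pos (Nat.mul_pos (by omega) (by omega)) hn
  have h5 : 2 ^ a ∣ (q ^ 2 - 1) * n := by
    rw [h4, padicValNat_dvd_iff_le h6.ne',
      padicValNat.mul (left_ne_zero_of_mul h6.ne') hn.ne',
      padicValNat.mul (by omega) (by omega)]
    have : padicValNat 2 2 = 1 := padicValNat_self
    omega
  exact Nat.le_of_dvd (by rwa [h4]) h5

theorem three_pow_le_of_dvd_pow_sub_one {q n a : ℕ} (hq : ¬ 3 ∣ q) (hq1 : 1 < q) (hn : 0 < n)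
    (hq9 : ¬ 9 ∣ q ^ 2 - 1) (h : 3 ^ a ∣ q ^ n - 1) : 3 ^ a ≤ 3 * n := by
  have h1 : 3 ^ a ∣ (q ^ 2) ^ n - 1 := h.trans (by
    rw [← pow_mul, mul_comm, pow_mul]; simpa using Nat.sub_dvd_pow_sub_pow (q ^ n) 1 2)
  have hq2 : 1 < q ^ 2 := Nat.one_lt_pow (by norm_num) hq1
  have hne : (q ^ 2) ^ n - 1 ≠ 0 := by
    have := Nat.one_lt_pow hn.ne' hq2
    omega
  have h2 := (padicValNat_dvd_iff_le hne).1 h1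
  have hmod : q ^ 2 % 3 = 1 := by
    rw [Nat.pow_mod]
    rcases (by omega : q % 3 = 1 ∨ q % 3 = 2) with h | h <;> simp [h]
  have h3 := padicValNat.pow_sub_pow (p := 3) (by decide) (x := q ^ 2) (y := 1) hq2 (by omega)
    (by omega) (n := n) hn.ne'
  have h4 : padicValNat 3 (q ^ 2 - 1) ≤ 1 := by
    by_contra hcon
    exact hq9 ((padicValNat_dvd_iff_le (p := 3) (by omega)).2 (not_le.1 hcon))
  rw [one_pow] at h3
  refine Nat.le_of_dvd (by positivity) ?_
  rw [padicValNat_dvd_iff_le (by positivity), padicValNat.mul (by norm_num) hn.ne',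
    padicValNat_self]
  omega

theorem three_pow_mod_eight (n : ℕ) : 3 ^ n % 8 = 1 ∨ 3 ^ n % 8 = 3 := by
  induction n with
  | zero => simp
  | succ n ih => rw [pow_succ]; omega

theorem seven_pow_mod_eight (n : ℕ) : 7 ^ n % 8 = 1 ∨ 7 ^ n % 8 = 7 := by
  induction n with
  | zero => simp
  | succ n ih => rw [pow_succ]; omega

theorem two_pow_mod_seven (n : ℕ) : 2 ^ n % 7 = 1 ∨ 2 ^ n % 7 = 2 ∨ 2 ^ n % 7 = 4 := by
  induction n with
  | zero => simp
  | succ n ih => rw [pow_succ]; omega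

theorem false_of_even {N : ℕ} (hN : 1000 ≤ N) (heven : N % 2 = 0)
    (h : ∀ p, p.Prime → p ∣ N ∨ p ∣ N - 2 ∨ p ∣ N - 3 → p < 5) : False := by
  obtain ⟨a, b, hab⟩ := exists_eq_two_pow_mul_three_pow (by omega : N - 3 ≠ 0)
    fun p hp hd => h p hp (by tauto)
  obtain ⟨c, e, hce⟩ := exists_eq_two_pow_mul_three_pow (by omega : N - 2 ≠ 0)
    fun p hp hd => h p hp (by tauto)
  have ha : a = 0 := by
    by_contra h0
    have : 2 ∣ N - 3 := hab ▸ (dvd_pow_self 2 h0).mul_right _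
    omega
  subst ha
  rw [pow_zero, one_mul] at hab
  have hb : b ≠ 0 := by rintro rfl; simp at hab; omega
  have h3 : 3 ∣ N - 3 := hab ▸ dvd_pow_self 3 hb
  have he : e = 0 := by
    by_contra h0
    have : 3 ∣ N - 2 := hce ▸ (dvd_pow_self 3 h0).mul_left _
    omega
  subst he
  rw [pow_zero, mul_one] at hce
  have hc : 3 ≤ c := by
    by_contra h0
    have := Nat.pow_le_pow_right (by norm_num : 0 < 2) (by omega : c ≤ 2)
    omega
  have h8 : 8 ∣ N - 2 := hce ▸ pow_dvd_pow 2 hc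
  have h9 := three_pow_mod_eight b
  omega

theorem pow_sub_one_le_of_eq {q n a b : ℕ} (hq : q % 2 = 1) (hq3 : ¬ 3 ∣ q) (hq1 : 1 < q)
    (hq9 : ¬ 9 ∣ q ^ 2 - 1) (hn : 0 < n) (h : q ^ n - 1 = 2 ^ a * 3 ^ b) :
    q ^ n - 1 ≤ ((q ^ 2 - 1) * n) * (3 * n) := by
  rw [h]
  exact Nat.mul_le_mul (two_pow_le_of_dvd_pow_sub_one hq hq1 hn (h ▸ Dvd.intro _ rfl))
    (three_pow_le_of_dvd_pow_sub_one hq3 hq1 hn hq9 (h ▸ Dvd.intro_left _ rfl))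

theorem five_pow_sub_one_ne {n a b : ℕ} (hn : 900 ≤ 5 ^ n) : 5 ^ n - 1 ≠ 2 ^ a * 3 ^ b := by
  intro h
  have h5 : 5 ≤ n := by
    by_contra hcon
    have := Nat.pow_le_pow_right (by norm_num : 0 < 5) (by omega : n ≤ 4)
    omega
  have h1 := pow_sub_one_le_of_eq (by norm_num) (by norm_num) (by norm_num) (by norm_num)
    (by omega) h
  have h2 : ∀ k, 5 ≤ k → 72 * (k * k) + 1 < 5 ^ k := by
    intro k hk
    induction k, hk using Nat.le_induction with
    | base => norm_num
    | succ k hk ih => rw [pow_succ 5 k]; nlinarith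
  have h3 := h2 n h5
  norm_num at h1
  nlinarith

theorem seven_pow_sub_one_ne {n a b : ℕ} (hn : 900 ≤ 7 ^ n) : 7 ^ n - 1 ≠ 2 ^ a * 3 ^ b := by
  intro h
  have h5 : 4 ≤ n := by
    by_contra hcon
    have := Nat.pow_le_pow_right (by norm_num : 0 < 7) (by omega : n ≤ 3)
    omega
  have h1 := pow_sub_one_le_of_eq (by norm_num) (by norm_num) (by norm_num) (by norm_num)
    (by omega) h
  have h2 : ∀ k, 4 ≤ k → 144 * (k * k) + 1 < 7 ^ k := by
    intro k hk
    induction k, hk using Nat.le_induction with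
    | base => norm_num
    | succ k hk ih => rw [pow_succ 7 k]; nlinarith
  have h3 := h2 n h5
  norm_num at h1
  nlinarith

theorem three_pow_sub_one_ne {n a : ℕ} (hn : 100 ≤ 3 ^ n) : 3 ^ n - 1 ≠ 2 ^ a := by
  intro h
  have h5 : 4 ≤ n := by
    by_contra hcon
    have := Nat.pow_le_pow_right (by norm_num : 0 < 3) (by omega : n ≤ 3)
    omega
  have h1 := two_pow_le_of_dvd_pow_sub_one (q := 3) (n := n) (a := a) (by norm_num) (by norm_num)
    (by omega) (by rw [h])
  have h2 : ∀ k, 4 ≤ k → (3 ^ 2 - 1) * k + 1 < 3 ^ k := by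
    intro k hk
    induction k, hk using Nat.le_induction with
    | base => norm_num
    | succ k hk ih => rw [pow_succ]; omega
  have := h2 n h5
  omega

theorem eq_zero_of_eq_three_pow_mul {n a b c : ℕ} (h : n = 3 ^ a * 5 ^ b * 7 ^ c) :
    (n % 3 ≠ 0 → a = 0) ∧ (n % 5 ≠ 0 → b = 0) ∧ (n % 7 ≠ 0 → c = 0) := by
  refine ⟨fun h3 => ?_, fun h5 => ?_, fun h7 => ?_⟩ <;> by_contra h0
  · exact h3 (Nat.mod_eq_zero_of_dvd (h ▸ ((dvd_pow_self 3 h0).mul_right _).mul_right _))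
  · exact h5 (Nat.mod_eq_zero_of_dvd (h ▸ ((dvd_pow_self 5 h0).mul_left _).mul_right _))
  · exact h7 (Nat.mod_eq_zero_of_dvd (h ▸ (dvd_pow_self 7 h0).mul_left _))

theorem false_of_two_pow_add {a c u v c' u' v' : ℕ} (ha : 900 ≤ 2 ^ a)
    (hx : 2 ^ a + 1 = 3 ^ c * 5 ^ u * 7 ^ v) (hy : 2 ^ a + 3 = 3 ^ c' * 5 ^ u' * 7 ^ v') :
    False := by
  obtain ⟨hc, hu, hv⟩ := eq_zero_of_eq_three_pow_mul hx
  obtain ⟨hc', hu', hv'⟩ := eq_zero_of_eq_three_pow_mul hy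
  have h7 := two_pow_mod_seven a
  obtain rfl : v = 0 := hv (by clear hc hu hv hc' hu' hv' hx hy; omega)
  by_cases h5 : (2 ^ a + 1) % 5 = 0
  · by_cases h3 : (2 ^ a + 1) % 3 = 0
    · obtain rfl : c' = 0 := hc' (by clear hc hu hv hc' hu' hv' hx hy; omega)
      obtain rfl : u' = 0 := hu' (by clear hc hu hv hc' hu' hv' hx hy; omega)
      simp only [pow_zero, one_mul] at hy
      have h8 : 2 ^ a % 8 = 0 := by
        have : 3 ≤ a := by
          by_contra h0
          have := Nat.pow_le_pow_right (by norm_num : 0 < 2) (by omega : a ≤ 2)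
          linarith
        exact Nat.mod_eq_zero_of_dvd (pow_dvd_pow 2 this)
      have h9 := seven_pow_mod_eight v'
      rw [← hy] at h9
      clear hc hu hv hc' hu' hv' hx hy
      omega
    · obtain rfl := hc h3
      simp only [pow_zero, mul_one, one_mul] at hx
      refine five_pow_sub_one_ne (n := u) (a := a) (b := 0) (by linarith) ?_
      rw [← hx, pow_zero, mul_one, Nat.add_sub_cancel]
  · obtain rfl := hu h5
    simp only [pow_zero, mul_one] at hx
    refine three_pow_sub_one_ne (n := c) (a := a) (by linarith) ?_
    rw [← hx, Nat.add_sub_cancel]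

theorem false_of_two_pow_mul_three_pow_add {M a b c u v c' u' v' : ℕ} (hb : b ≠ 0)
    (hM : M = 2 ^ a * 3 ^ b) (ha : 900 ≤ M) (hx : M + 1 = 3 ^ c * 5 ^ u * 7 ^ v)
    (hy : M + 3 = 3 ^ c' * 5 ^ u' * 7 ^ v') : False := by
  obtain ⟨hc, hu, hv⟩ := eq_zero_of_eq_three_pow_mul hx
  obtain ⟨hc', hu', hv'⟩ := eq_zero_of_eq_three_pow_mul hy
  have h3 : M % 3 = 0 := by
    rw [hM]
    exact Nat.mod_eq_zero_of_dvd ((dvd_pow_self 3 hb).mul_left _)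
  obtain rfl : c = 0 := hc (by clear hc hu hv hc' hu' hv' hx hy hM; omega)
  rw [pow_zero, one_mul] at hx
  by_cases h5 : (M + 1) % 5 = 0
  · by_cases h7 : (M + 1) % 7 = 0
    · obtain rfl : u' = 0 := hu' (by clear hc hu hv hc' hu' hv' hx hy hM; omega)
      obtain rfl : v' = 0 := hv' (by clear hc hu hv hc' hu' hv' hx hy hM; omega)
      clear hc hu hv hc' hu' hv' hx
      simp only [pow_zero, mul_one] at hy
      have hc2 : 2 ≤ c' := by
        by_contra h0
        have := Nat.pow_le_pow_right (by norm_num : 0 < 3) (by omega : c' ≤ 1)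
        clear hM h5 h7 h3
        omega
      obtain ⟨k, rfl⟩ : ∃ k, c' = k + 1 := ⟨c' - 1, (Nat.sub_add_cancel (one_le_two.trans hc2)).symm⟩
      have h9 : 3 ^ 2 ∣ M + 3 := by
        rw [hy]
        exact pow_dvd_pow 3 hc2
      have hb1 : b = 1 := by
        by_contra h0
        have : 3 ^ 2 ∣ M := by
          rw [hM]
          exact (pow_dvd_pow 3 (by omega : 2 ≤ b)).mul_left _
        clear hM h5 h7 h3 hy
        omega
      subst hb1
      rw [pow_succ] at hy
      rw [pow_one] at hM
      exact three_pow_sub_one_ne (n := k) (a := a) (by clear hM h5 h7 h3 h9; omega)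
        (by clear h5 h7 h3 h9; omega)
    · obtain rfl := hv h7
      rw [pow_zero, mul_one] at hx
      refine five_pow_sub_one_ne (n := u) (a := a) (b := b) (ha.trans (Nat.le_succ M |>.trans_eq hx)) ?_
      rw [← hx, ← hM, Nat.add_sub_cancel]
  · obtain rfl := hu h5
    rw [pow_zero, one_mul] at hx
    refine seven_pow_sub_one_ne (n := v) (a := a) (b := b) (ha.trans (Nat.le_succ M |>.trans_eq hx)) ?_
    rw [← hx, ← hM, Nat.add_sub_cancel]

theorem false_of_odd {N : ℕ} (hN : 1000 ≤ N) (hodd : N % 2 = 1)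
    (h : ∀ p, p.Prime → p ∣ N ∨ p ∣ N - 2 → p < 11)
    (h3 : ∀ p, p.Prime → p ∣ N - 3 → p < 5) : False := by
  obtain ⟨a, b, hab⟩ := exists_eq_two_pow_mul_three_pow (by omega : N - 3 ≠ 0) h3
  obtain ⟨c, u, v, hx⟩ := exists_eq_three_pow_mul_five_pow_mul_seven_pow
    (by omega : (N - 2) % 2 = 1) fun p hp hd => h p hp (by tauto)
  obtain ⟨c', u', v', hy⟩ := exists_eq_three_pow_mul_five_pow_mul_seven_pow hodd
    fun p hp hd => h p hp (by tauto)
  rw [show N - 2 = N - 3 + 1 by omega] at hx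
  rw [show N = N - 3 + 3 by omega] at hy
  by_cases hb : b = 0
  · subst hb
    rw [hab, pow_zero, mul_one] at hx
    rw [show N - 3 + 3 = 2 ^ a * 3 ^ 0 + 3 by rw [hab], pow_zero, mul_one] at hy
    rw [pow_zero, mul_one] at hab
    exact false_of_two_pow_add (by omega) hx hy
  · exact false_of_two_pow_mul_three_pow_add hb hab (by omega) hx hy

theorem degSeq_pair (n m : ℕ) : degSeq ![n, m] = ![m, n + 1] := by
  funext i
  fin_cases i <;> simp [degSeq]

theorem wronskHe_degSeq_pair (n m : ℕ) : wronskHe (degSeq ![n, m]) = pairWr m (n + 1) := by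
  rw [degSeq_pair, wronskHe, Matrix.det_fin_two, pairWr]
  simp
  ring

theorem vand_degSeq_pair (n m : ℕ) : vand (degSeq ![n, m]) = ((n + 1 : ℕ) : ℤ) - m := by
  have h : Finset.Iio (1 : Fin 2) = {0} := by decide
  have h' : Finset.Iio (0 : Fin 2) = ∅ := by decide
  rw [degSeq_pair, vand, Fin.prod_univ_two, h, h']
  simp

theorem sStat_degSeq_pair (n m : ℕ) : sStat (degSeq ![n, m]) = pairOrder m (n + 1) := by
  rw [degSeq_pair, sStat, dStat, pairOrder]
  simp only [Finset.card_filter, Fin.sum_univ_two]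
  simp only [Matrix.cons_val_zero, Matrix.cons_val_one, Nat.odd_iff, Nat.even_iff]
  rcases Nat.mod_two_eq_zero_or_one m with h | h <;>
    rcases Nat.mod_two_eq_zero_or_one (n + 1) with h' | h' <;> simp [h, h']

theorem choose_le_mul_prod {N d e k : ℕ} (hkN : k ≤ N) (hN : 0 < N)
    (bad : ∀ p r, p.Prime → r < k → r ≠ e → p ∣ N - r → p < d) :
    N.choose k ≤ N * ∏ p ∈ d.primesBelow, p ^ (N.choose k).factorization p := by
  have hC : N.choose k ≠ 0 := (Nat.choose_pos hkN).ne'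
  obtain ⟨M, hM0, hMN, hM⟩ : ∃ M, M ≠ 0 ∧ M ≤ N ∧
      M * ∏ i ∈ (range k).erase e, (N - i) = N.descFactorial k := by
    rw [Nat.descFactorial_eq_prod_range]
    by_cases he : e ∈ range k
    · exact ⟨N - e, by rw [mem_range] at he; omega, Nat.sub_le _ _,
        mul_prod_erase _ (fun i => N - i) he⟩
    · exact ⟨1, one_ne_zero, by omega, by rw [one_mul, erase_eq_of_notMem he]⟩
  have hA0 : ∏ i ∈ (range k).erase e, (N - i) ≠ 0 := by
    rw [prod_ne_zero_iff]
    intro i hi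
    have := mem_range.1 (mem_of_mem_erase hi)
    omega
  have hP0 : ∏ p ∈ d.primesBelow, p ^ (N.choose k).factorization p ≠ 0 := by
    rw [prod_ne_zero_iff]
    exact fun p hp => pow_ne_zero _ (Nat.prime_of_mem_primesBelow hp).ne_zero
  have hdvd : N.choose k ∣ M * ∏ p ∈ d.primesBelow, p ^ (N.choose k).factorization p := by
    rw [← Nat.factorization_prime_le_iff_dvd hC (mul_ne_zero hM0 hP0)]
    intro p hp
    by_cases hpd : p < d
    · refine ((hp.pow_dvd_iff_le_factorization (mul_ne_zero hM0 hP0)).1 ?_)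
      exact (dvd_prod_of_mem (fun p => p ^ (N.choose k).factorization p)
        (Nat.mem_primesBelow.2 ⟨hpd, hp⟩)).mul_left _
    · have hA : (∏ i ∈ (range k).erase e, (N - i)).factorization p = 0 := by
        refine Nat.factorization_eq_zero_of_not_dvd fun h => ?_
        obtain ⟨i, hi, hpi⟩ := (hp.prime.dvd_finsetProd_iff _).1 h
        rw [mem_erase, mem_range] at hi
        exact hpd (bad p i hp hi.2 hi.1 hpi)
      have h1 : (N.choose k).factorization p ≤ (N.descFactorial k).factorization p := by
        refine (Nat.factorization_le_iff_dvd hC ?_).2 ?_ p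
        · rw [← hM]
          exact mul_ne_zero hM0 hA0
        · rw [Nat.descFactorial_eq_factorial_mul_choose]
          exact dvd_mul_left _ _
      rw [← hM, Nat.factorization_mul hM0 hA0, Finsupp.add_apply, hA, add_zero] at h1
      rw [Nat.factorization_mul hM0 hP0, Finsupp.add_apply]
      exact h1.trans (Nat.le_add_right _ _)
  exact (Nat.le_of_dvd (Nat.pos_of_ne_zero (mul_ne_zero hM0 hP0)) hdvd).trans
    (Nat.mul_le_mul_right _ hMN)

theorem choose_le_pow_card {N d e k : ℕ} (hkN : k ≤ N) (hN : 0 < N)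
    (bad : ∀ p r, p.Prime → r < k → r ≠ e → p ∣ N - r → p < d) :
    N.choose k ≤ N ^ (d.primesBelow.card + 1) := by
  refine (choose_le_mul_prod hkN hN bad).trans ?_
  rw [pow_succ']
  exact Nat.mul_le_mul_left _ (prod_le_pow_card _ _ _ fun p _ => Nat.pow_factorization_choose_le hN)

/-- Small primes contribute at most `N` each, and a prime in `(√N, d)` dividing the binomial
coefficient contributes only itself. -/
theorem choose_le_pow_card_mul_primorial {N d e k s y : ℕ} (hkN : k ≤ N) (hN : 0 < N)
    (hs : N < s ^ 2) (hy : ∀ p, p.Prime → y < p → p < d → ¬ p ∣ N.choose k)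
    (bad : ∀ p r, p.Prime → r < k → r ≠ e → p ∣ N - r → p < d) :
    N.choose k ≤ N ^ (s.primesBelow.card + 1) * primorial y := by
  refine (choose_le_mul_prod hkN hN bad).trans ?_
  rw [pow_succ', mul_assoc]
  refine Nat.mul_le_mul_left _ ?_
  have h1 : ∏ p ∈ d.primesBelow, p ^ (N.choose k).factorization p ≤
      ∏ p ∈ s.primesBelow ∪ (y + 1).primesBelow, if p < s then N else p := by
    rw [← prod_filter_mul_prod_filter_not d.primesBelow
      (fun p => p ∈ s.primesBelow ∪ (y + 1).primesBelow)]
    rw [prod_eq_one (s := d.primesBelow.filter fun p => ¬ p ∈ s.primesBelow ∪ (y + 1).primesBelow)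
      (f := fun p => p ^ (N.choose k).factorization p), mul_one]
    · refine (prod_le_prod' (g := fun p => if p < s then N else p) fun p hp => ?_).trans ?_
      · split_ifs with h
        · exact Nat.pow_factorization_choose_le hN
        · refine (Nat.pow_le_pow_right ?_ (Nat.factorization_choose_le_one ?_)).trans_eq
            (pow_one p)
          · rw [mem_filter] at hp
            exact (Nat.prime_of_mem_primesBelow hp.1).pos
          · exact hs.trans_le (Nat.pow_le_pow_left (not_lt.1 h) 2)
      · refine prod_le_prod_of_subset_of_one_le' ?_ fun p hp _ => ?_
        · exact fun p hp => (mem_filter.1 hp).2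
        · split_ifs
          · exact hN
          · rw [mem_union] at hp
            rcases hp with hp | hp <;> exact (Nat.prime_of_mem_primesBelow hp).pos
    · intro p hp
      rw [mem_filter, Nat.mem_primesBelow, mem_union, Nat.mem_primesBelow,
        Nat.mem_primesBelow] at hp
      have hyp : y < p := by
        by_contra h
        exact hp.2 (Or.inr ⟨by omega, hp.1.2⟩)
      rw [Nat.factorization_eq_zero_of_not_dvd (hy p hp.1.2 hyp hp.1.1), pow_zero]
  refine h1.trans ?_
  rw [prod_ite]
  refine Nat.mul_le_mul ?_ ?_
  · rw [prod_const]
    refine Nat.pow_le_pow_right hN (card_le_card fun p hp => ?_)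
    rw [mem_filter, mem_union] at hp
    rw [Nat.mem_primesBelow]
    exact ⟨hp.2, hp.1.elim Nat.prime_of_mem_primesBelow Nat.prime_of_mem_primesBelow⟩
  · rw [primorial]
    refine prod_le_prod_of_subset_of_one_le' (fun p hp => ?_) fun p hp _ =>
      (mem_filter.1 hp).2.pos
    rw [mem_filter, mem_union, Nat.mem_primesBelow, Nat.mem_primesBelow] at hp
    rw [mem_filter, mem_range]
    rcases hp with ⟨hp | hp, h⟩
    · exact absurd hp.1 h
    · exact hp

theorem exists_dvd_of_card_lt {N W L : ℕ} (hWN : W < N) (S T : Finset ℕ)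
    (hS : ∀ r ∈ S, r ≤ W) (hL0 : L ≠ 0) (hL : ∀ j, 1 ≤ j → j ≤ W → j ∣ L)
    (hT : ∀ p r, p.Prime → r ∈ S → p ∣ N - r → p ∈ T) (hcard : T.card < S.card) :
    ∃ r ∈ S, N - r ∣ L := by
  have hSne : S.Nonempty := card_pos.1 (by omega)
  choose f hfS hf using fun p : ℕ => S.exists_max_image (fun r => (N - r).factorization p) hSne
  obtain ⟨r, hrS, hr⟩ : ∃ r ∈ S, r ∉ T.image f := by
    by_contra! h
    exact absurd (card_le_card (show S ⊆ T.image f from h))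
      (not_le.2 (card_image_le.trans_lt hcard))
  have hrW := hS r hrS
  refine ⟨r, hrS, (Nat.factorization_prime_le_iff_dvd (by omega) hL0).1 fun p hp => ?_⟩
  by_cases hpr : p ∣ N - r
  · have hpT := hT p r hp hrS hpr
    have hne : f p ≠ r := fun h => hr (mem_image.2 ⟨p, hpT, h⟩)
    have hfW := hS _ (hfS p)
    have h1 : p ^ (N - r).factorization p ∣ N - r := Nat.ordProj_dvd _ _
    have h2 : p ^ (N - r).factorization p ∣ N - f p :=
      (pow_dvd_pow p (hf p r hrS)).trans (Nat.ordProj_dvd _ _)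
    rw [← hp.pow_dvd_iff_le_factorization hL0]
    rcases lt_or_gt_of_ne hne with h | h
    · have := Nat.dvd_sub h2 h1
      rw [show N - f p - (N - r) = r - f p by omega] at this
      exact this.trans (hL _ (by omega) (by omega))
    · have := Nat.dvd_sub h1 h2
      rw [show N - r - (N - f p) = f p - r by omega] at this
      exact this.trans (hL _ (by omega) (by omega))
  · rw [Nat.factorization_eq_zero_of_not_dvd hpr]
    exact Nat.zero_le _

theorem not_forall_lt_of_le_twelve {N W d e : ℕ} (hN : 1000 ≤ N) (hd : 6 ≤ d) (hd' : d ≤ 12)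
    (hW : 271 * d + 200 ≤ 442 * W) (hW' : 442 * W < 271 * d + 642)
    (bad : ∀ p r, p.Prime → r ≤ W → r ≠ e → p ∣ N - r → p < d + 4) : False := by
  have hW8 : W ≤ 8 := by omega
  have hcard : (d + 4).primesBelow.card < W := by
    have : (d = 6 ∧ W = 5) ∨ (d = 7 ∧ W = 5) ∨ (d = 8 ∧ W = 6) ∨ (d = 9 ∧ W = 6) ∨
      (d = 10 ∧ W = 7) ∨ (d = 11 ∧ W = 8) ∨ (d = 12 ∧ W = 8) := by omega
    rcases this with ⟨rfl, rfl⟩ | ⟨rfl, rfl⟩ | ⟨rfl, rfl⟩ | ⟨rfl, rfl⟩ | ⟨rfl, rfl⟩ | ⟨rfl, rfl⟩ |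
      ⟨rfl, rfl⟩ <;> decide
  obtain ⟨r, hr, h⟩ := exists_dvd_of_card_lt (N := N) (W := W) (L := 840) (by omega)
    ((range (W + 1)).erase e) (d + 4).primesBelow
    (fun r hr => Nat.lt_succ_iff.1 (mem_range.1 (mem_of_mem_erase hr))) (by norm_num)
    (fun j h1 h2 => by have := h2.trans hW8; interval_cases j <;> norm_num)
    (fun p r hp hr h => Nat.mem_primesBelow.2 ⟨bad p r hp
      (Nat.lt_succ_iff.1 (mem_range.1 (mem_of_mem_erase hr))) (ne_of_mem_erase hr) h, hp⟩)
    (hcard.trans_le (by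
      have := pred_card_le_card_erase (s := range (W + 1)) (a := e)
      rwa [card_range] at this))
  have h1 := Nat.le_of_dvd (by norm_num) h
  have h2 := mem_range.1 (mem_of_mem_erase hr)
  omega

/-- Every three consecutive terms `a < b < c` of the list satisfy `0.8493 c ≤ a`, and the last
term exceeds `40000`. -/
def isLadder : ℕ → ℕ → List ℕ → Bool
  | _, b, [] => Nat.blt 40000 b
  | a, b, c :: l => Nat.blt a b && Nat.ble (c * 8493) (10000 * a) && isLadder b c l

theorem exists_primes_of_isLadder {N : ℕ} (hN : N ≤ 40000) (l : List ℕ) (a b : ℕ)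
    (hl : ∀ p ∈ a :: b :: l, p.Prime) (h : isLadder a b l = true) (hb : b ≤ N) :
    ∃ p q, p.Prime ∧ q.Prime ∧ p < q ∧ q ≤ N ∧ 8493 * N ≤ 10000 * p := by
  induction l generalizing a b with
  | nil =>
    rw [isLadder, Nat.blt_eq] at h
    omega
  | cons c l ih =>
    rw [isLadder, Bool.and_eq_true, Bool.and_eq_true, Nat.blt_eq, Nat.ble_eq] at h
    by_cases hc : c ≤ N
    · exact ih b c (fun p hp => hl p (List.mem_cons_of_mem _ hp)) h.2 hc
    · exact ⟨a, b, hl a (by simp), hl b (by simp), h.1.1, hb, by omega⟩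

theorem exists_primes_of_le {N : ℕ} (hN : 1000 ≤ N) (hN' : N ≤ 40000) :
    ∃ p q, p.Prime ∧ q.Prime ∧ p < q ∧ q ≤ N ∧ 8493 * N ≤ 10000 * p := by
  refine exists_primes_of_isLadder hN' [1069, 1153, 1249, 1327, 1439, 1559, 1669, 1801, 1951,
    2113, 2287, 2477, 2683, 2909, 3137, 3391, 3677, 3967, 4297, 4657, 5039, 5449, 5903, 6397,
    6917, 7499, 8123, 8807, 9551, 10357, 11213, 12157, 13183, 14293, 15497, 16787, 18199, 19727,
    21391, 23197, 25153, 27277, 29581, 32077, 34781, 37717, 40903] 919 997 ?_ (by decide)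
    (by omega)
  simp only [List.forall_mem_cons, List.not_mem_nil, false_imp_iff, implies_true, and_true]
  norm_num

theorem not_forall_lt_of_lt_four_mul {N W d e : ℕ} (hN : 1001 ≤ N) (hN' : N ≤ 40000)
    (hNd : N < 4 * d) (hW : 271 * d + 200 ≤ 442 * W) (hNW : d + W + 1 ≤ N)
    (bad : ∀ p r, p.Prime → r ≤ W → r ≠ e → p ∣ N - r → p < d + 4) : False := by
  obtain ⟨p, q, hp, hq, hpq, hqN, h⟩ := exists_primes_of_le (by omega : 1000 ≤ N) hN'
  by_cases he : N - p = e
  · have := bad q (N - q) hq (by omega) (by omega) (by rw [Nat.sub_sub_self hqN])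
    omega
  · have := bad p (N - p) hp (by omega) he (by rw [Nat.sub_sub_self (by omega)])
    omega

/-- A superset of the primes: the primes up to `31` and the numbers `n > 1` coprime to all of them. -/
def isSieved (n : ℕ) : Bool :=
  Nat.blt 1 n && Nat.beq (Nat.gcd 200560490130 n) 1 ||
    [2, 3, 5, 7, 11, 13, 17, 19, 23, 29, 31].contains n

theorem isSieved_of_prime {p : ℕ} (hp : p.Prime) : isSieved p = true := by
  rw [isSieved, Bool.or_eq_true, Bool.and_eq_true, Nat.blt_eq, Nat.beq_eq]
  by_cases h : p ∣ 200560490130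
  · right
    rw [show 200560490130 = 2 * (3 * (5 * (7 * (11 * (13 * (17 * (19 * (23 * (29 * 31)))))))))
      by norm_num] at h
    simp only [hp.dvd_mul, Nat.prime_dvd_prime_iff_eq hp (by norm_num : Nat.Prime 2),
      Nat.prime_dvd_prime_iff_eq hp (by norm_num : Nat.Prime 3),
      Nat.prime_dvd_prime_iff_eq hp (by norm_num : Nat.Prime 5),
      Nat.prime_dvd_prime_iff_eq hp (by norm_num : Nat.Prime 7),
      Nat.prime_dvd_prime_iff_eq hp (by norm_num : Nat.Prime 11),
      Nat.prime_dvd_prime_iff_eq hp (by norm_num : Nat.Prime 13),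
      Nat.prime_dvd_prime_iff_eq hp (by norm_num : Nat.Prime 17),
      Nat.prime_dvd_prime_iff_eq hp (by norm_num : Nat.Prime 19),
      Nat.prime_dvd_prime_iff_eq hp (by norm_num : Nat.Prime 23),
      Nat.prime_dvd_prime_iff_eq hp (by norm_num : Nat.Prime 29),
      Nat.prime_dvd_prime_iff_eq hp (by norm_num : Nat.Prime 31)] at h
    simpa using h
  · left
    exact ⟨hp.one_lt, (hp.coprime_iff_not_dvd.2 h).symm⟩

/-- With `N₀ = max 1001 (4 * a)` and `k = ⌈(271 * a + 200) / 442⌉ + 1`, the binomial coefficient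
`N₀.choose k` exceeds `N₀ ^ (π + 1)`, where `π` bounds the number of primes
below `b + 3`. -/
def isBlock (a b : ℕ) : Bool :=
  Nat.ble (Nat.count (fun n => isSieved n = true) (b + 3) + 1) ((271 * a + 641) / 442 + 1) &&
    Nat.blt ((max 1001 (4 * a)) ^ (Nat.count (fun n => isSieved n = true) (b + 3) + 1) *
      ((271 * a + 641) / 442 + 1).factorial)
      ((max 1001 (4 * a)).descFactorial ((271 * a + 641) / 442 + 1))

def areBlocks : ℕ → List ℕ → Bool
  | a, [] => Nat.blt 1000 a
  | a, b :: l => isBlock a b && areBlocks b l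

theorem exists_isBlock {d : ℕ} (hd : d ≤ 1000) (l : List ℕ) (a : ℕ) (h : areBlocks a l = true)
    (ha : a ≤ d) : ∃ a b, isBlock a b = true ∧ a ≤ d ∧ d < b := by
  induction l generalizing a with
  | nil =>
    rw [areBlocks, Nat.blt_eq] at h
    omega
  | cons b l ih =>
    rw [areBlocks, Bool.and_eq_true] at h
    by_cases hb : b ≤ d
    · exact ih b h.2 hb
    · exact ⟨a, b, h.1, ha, not_le.1 hb⟩

theorem areBlocks_thirteen : areBlocks 13 [14, 16, 20, 26, 34, 44, 58, 76, 100, 134, 176, 224,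
    266, 310, 370, 440, 538, 656, 818, 1028] = true := by
  decide +kernel

theorem pow_mul_descFactorial_le {M N : ℕ} (h : M ≤ N) (k : ℕ) :
    N ^ k * M.descFactorial k ≤ M ^ k * N.descFactorial k := by
  induction k with
  | zero => simp
  | succ k ih =>
    rw [Nat.descFactorial_succ, Nat.descFactorial_succ, pow_succ, pow_succ]
    have h1 : N * (M - k) ≤ M * (N - k) := by
      rw [Nat.mul_sub, Nat.mul_sub, mul_comm M N]
      exact Nat.sub_le_sub_left (Nat.mul_le_mul_right _ h) _
    calc _ = (N * (M - k)) * (N ^ k * M.descFactorial k) := by ring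
      _ ≤ (M * (N - k)) * (M ^ k * N.descFactorial k) := Nat.mul_le_mul h1 ih
      _ = _ := by ring

theorem pow_lt_choose {M N J k : ℕ} (hM : 0 < M) (h : M ≤ N) (hJ : J ≤ k)
    (hlt : M ^ J * k.factorial < M.descFactorial k) : N ^ J < N.choose k := by
  have h1 := pow_mul_descFactorial_le h k
  rw [Nat.descFactorial_eq_factorial_mul_choose N] at h1
  have h2 : N ^ J * M ^ k ≤ N ^ k * M ^ J := by
    obtain ⟨i, rfl⟩ := Nat.exists_eq_add_of_le hJ
    rw [pow_add, pow_add]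
    calc _ = N ^ J * M ^ J * M ^ i := by ring
      _ ≤ N ^ J * M ^ J * N ^ i := Nat.mul_le_mul_left _ (Nat.pow_le_pow_left h i)
      _ = _ := by ring
  by_contra! hle
  have h3 : N ^ k * (M ^ J * k.factorial) < N ^ k * M.descFactorial k :=
    Nat.mul_lt_mul_of_pos_left hlt (pow_pos (hM.trans_le h) k)
  have h4 : M ^ k * (k.factorial * N.choose k) ≤ M ^ k * (k.factorial * N ^ J) :=
    Nat.mul_le_mul_left _ (Nat.mul_le_mul_left _ hle)
  have h5 := Nat.mul_le_mul_right k.factorial h2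
  linarith

theorem not_forall_lt_of_le_thousand {N W d e : ℕ} (hN : 1001 ≤ N) (hNd : 4 * d ≤ N)
    (hd : 13 ≤ d) (hd' : d ≤ 1000) (hW : 271 * d + 200 ≤ 442 * W)
    (bad : ∀ p r, p.Prime → r ≤ W → r ≠ e → p ∣ N - r → p < d + 4) : False := by
  obtain ⟨a, b, h, had, hdb⟩ := exists_isBlock hd' _ _ areBlocks_thirteen hd
  rw [isBlock, Bool.and_eq_true, Nat.ble_eq, Nat.blt_eq] at h
  obtain ⟨hJ, hlt⟩ := h
  have h1 := pow_lt_choose (by omega) (by omega : max 1001 (4 * a) ≤ N) hJ hlt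
  have h2 := choose_le_pow_card (N := N) (d := b + 3) (e := e)
    (k := (271 * a + 641) / 442 + 1) (by omega) (by omega) fun p r hp hr hre hd => by
      have := bad p r hp (by omega) hre hd
      omega
  have h3 : Nat.primeCounting' (b + 3) ≤ _ :=
    Nat.count_mono_left fun p _ => isSieved_of_prime (p := p)
  rw [Nat.primesBelow_card_eq_primeCounting'] at h2
  exact absurd (h2.trans (Nat.pow_le_pow_right (by omega) (Nat.succ_le_succ h3))) (not_le.2 h1)

theorem padicValNat_factorial_add_lt {p k : ℕ} (hp : p.Prime) (hk : k < p) (hpk : p ≤ 42 * k) :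
    padicValNat p (21 * k).factorial + padicValNat p (14 * k).factorial +
      padicValNat p (6 * k).factorial + padicValNat p k.factorial <
      padicValNat p (42 * k).factorial := by
  have := Fact.mk hp
  have hb : ∀ n ≤ 42 * k, Nat.log p n < Nat.log p (42 * k) + 1 := fun n hn =>
    Nat.lt_succ_of_le (Nat.log_mono_right hn)
  rw [padicValNat_factorial (hb (21 * k) (by omega)), padicValNat_factorial (hb (14 * k) (by omega)),
    padicValNat_factorial (hb (6 * k) (by omega)), padicValNat_factorial (hb k (by omega)),
    padicValNat_factorial (hb (42 * k) le_rfl), ← sum_add_distrib, ← sum_add_distrib,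
    ← sum_add_distrib]
  have hdiv : ∀ q, 21 * k / q = 42 * k / q / 2 ∧ 14 * k / q = 42 * k / q / 3 ∧
      6 * k / q = 42 * k / q / 7 ∧ k / q = 42 * k / q / 42 := fun q => by
    refine ⟨?_, ?_, ?_, ?_⟩ <;> rw [Nat.div_div_eq_div_mul, mul_comm q, ← Nat.div_div_eq_div_mul]
      <;> congr 1 <;> omega
  refine sum_lt_sum (fun i _ => ?_) ⟨1, ?_, ?_⟩
  · obtain ⟨h1, h2, h3, h4⟩ := hdiv (p ^ i)
    rw [h1, h2, h3, h4]
    omega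
  · rw [mem_Ico]
    exact ⟨le_rfl, Nat.succ_lt_succ (Nat.log_pos hp.one_lt hpk)⟩
  · obtain ⟨h1, h2, h3, h4⟩ := hdiv (p ^ 1)
    rw [h1, h2, h3, h4, pow_one]
    have h5 : 1 ≤ 42 * k / p := (Nat.one_le_div_iff hp.pos).2 hpk
    have h6 : 42 * k / p < 42 := (Nat.div_lt_iff_lt_mul hp.pos).2 (by omega)
    omega

theorem factorial_mul_choose_mul_choose (k : ℕ) :
    (42 * k).factorial = ((21 * k).factorial * (14 * k).factorial * (6 * k).factorial *
      k.factorial) * ((42 * k).choose (21 * k) * (21 * k).choose (14 * k) *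
      (7 * k).choose (6 * k)) := by
  have h1 := Nat.choose_mul_factorial_mul_factorial (by omega : 21 * k ≤ 42 * k)
  have h2 := Nat.choose_mul_factorial_mul_factorial (by omega : 14 * k ≤ 21 * k)
  have h3 := Nat.choose_mul_factorial_mul_factorial (by omega : 6 * k ≤ 7 * k)
  rw [show 42 * k - 21 * k = 21 * k by omega] at h1
  rw [show 21 * k - 14 * k = 7 * k by omega] at h2
  rw [show 7 * k - 6 * k = k by omega] at h3
  rw [← h1]
  nth_rewrite 2 [← h2]
  rw [← h3]
  ring

theorem choose_mul_pow_le (a b x y : ℕ) :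
    (a + b).choose a * (x ^ a * y ^ b) ≤ (x + y) ^ (a + b) := by
  rw [add_pow]
  have := single_le_sum (f := fun i => x ^ i * y ^ (a + b - i) * (a + b).choose i)
    (s := range (a + b + 1)) (fun _ _ => Nat.zero_le _) (mem_range.2 (by omega : a < a + b + 1))
  rw [Nat.add_sub_cancel_left] at this
  exact (mul_comm _ _).trans_le this

theorem choose_mul_choose_mul_choose_le (k : ℕ) :
    (42 * k).choose (21 * k) * (21 * k).choose (14 * k) * (7 * k).choose (6 * k) ≤
      (2 ^ 22 * 3 ^ 15 * 7 ^ 7) ^ k := by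
  have h1 := choose_mul_pow_le (21 * k) (21 * k) 21 21
  have h2 := choose_mul_pow_le (14 * k) (7 * k) 14 7
  have h3 := choose_mul_pow_le (6 * k) k 6 1
  rw [show 21 * k + 21 * k = 42 * k by ring] at h1
  rw [show 14 * k + 7 * k = 21 * k by ring] at h2
  rw [show 6 * k + k = 7 * k by ring] at h3
  have h := Nat.mul_le_mul (Nat.mul_le_mul h1 h2) h3
  simp only [pow_mul, ← mul_pow, one_pow, mul_one] at h ⊢
  set A := (42 * k).choose (21 * k)
  set B := (21 * k).choose (14 * k)
  set D := (7 * k).choose (6 * k)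
  refine Nat.le_of_mul_le_mul_right (c := (21 ^ 42 * 14 ^ 14 * 7 ^ 7 * 6 ^ 6) ^ k) ?_
    (by positivity)
  calc _ = A * (21 ^ 21 * 21 ^ 21) ^ k * (B * (14 ^ 14 * 7 ^ 7) ^ k) * (D * (6 ^ 6) ^ k) := by
        rw [show 21 ^ 42 * 14 ^ 14 * 7 ^ 7 * 6 ^ 6 =
          (21 ^ 21 * 21 ^ 21) * (14 ^ 14 * 7 ^ 7) * 6 ^ 6 by norm_num, mul_pow, mul_pow]
        ring
    _ ≤ _ := h
    _ = _ := by
        rw [← mul_pow]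
        norm_num

theorem primorial_forty_two_mul_le (k : ℕ) :
    primorial (42 * k) ≤ (4 * (2 ^ 22 * 3 ^ 15 * 7 ^ 7)) ^ k := by
  rw [mul_pow]
  set M := (42 * k).choose (21 * k) * (21 * k).choose (14 * k) * (7 * k).choose (6 * k) with hM
  have hM0 : 0 < M := by
    refine Nat.mul_pos (Nat.mul_pos ?_ ?_) ?_ <;> exact Nat.choose_pos (by omega)
  have hdvd : ∏ p ∈ range (42 * k + 1) with p.Prime ∧ k < p, p ∣ M := by
    refine prod_primes_dvd _ (fun p hp => (mem_filter.1 hp).2.1.prime) fun p hp => ?_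
    rw [mem_filter, mem_range] at hp
    have := Fact.mk hp.2.1
    have h := padicValNat_factorial_add_lt hp.2.1 hp.2.2 (by omega)
    have h0 := fun n : ℕ => n.factorial_ne_zero
    rw [factorial_mul_choose_mul_choose, ← hM, padicValNat.mul (by simp [h0]) hM0.ne',
      padicValNat.mul (by simp [h0]) (h0 _), padicValNat.mul (by simp [h0]) (h0 _),
      padicValNat.mul (h0 _) (h0 _)] at h
    exact dvd_of_one_le_padicValNat (by omega)
  have hsplit : primorial (42 * k) ≤
      primorial k * ∏ p ∈ range (42 * k + 1) with p.Prime ∧ k < p, p := by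
    rw [primorial, primorial, ← prod_filter_mul_prod_filter_not _ (fun p => k < p), mul_comm,
      filter_filter, filter_filter]
    refine Nat.mul_le_mul_right _ (prod_le_prod_of_subset_of_one_le' (fun p hp => ?_)
      fun p hp _ => (mem_filter.1 hp).2.pos)
    rw [mem_filter, mem_range] at hp ⊢
    exact ⟨by omega, hp.2.1⟩
  exact hsplit.trans (Nat.mul_le_mul (primorial_le_four_pow k)
    ((Nat.le_of_dvd hM0 hdvd).trans (choose_mul_choose_mul_choose_le k)))

theorem primorial_le_pow (n : ℕ) :
    primorial n ≤ (4 * (2 ^ 22 * 3 ^ 15 * 7 ^ 7)) ^ (n / 42 + 1) :=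
  (primorial_mono (by omega)).trans (primorial_forty_two_mul_le _)

theorem card_primesBelow_le (s : ℕ) : 15 * s.primesBelow.card ≤ 150 + 4 * s := by
  rw [Nat.primesBelow_card_eq_primeCounting']
  have h31 : Nat.primeCounting' 31 = 10 := by decide
  rcases le_total s 31 with h | h
  · have := Nat.monotone_primeCounting' h
    omega
  · obtain ⟨n, rfl⟩ := Nat.exists_eq_add_of_le h
    have h1 := Nat.primeCounting'_add_le (a := 30) (k := 31) (by norm_num) (by norm_num) n
    rw [h31, show Nat.totient 30 = 8 by decide] at h1
    omega

theorem choose_mul_pow_le_choose_mul_pow {a b : ℕ} (hb : 0 < b) {i : ℕ} (hi : i ≤ a + b) :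
    a ^ i * b ^ (a + b - i) * (a + b).choose i ≤ a ^ a * b ^ b * (a + b).choose a := by
  have key : ∀ i, i < a + b → (a ^ (i + 1) * b ^ (a + b - (i + 1)) * (a + b).choose (i + 1)) *
      ((i + 1) * b) = (a ^ i * b ^ (a + b - i) * (a + b).choose i) * ((a + b - i) * a) := by
    intro i hi
    have h := Nat.choose_succ_right_eq (a + b) i
    obtain ⟨c, hc⟩ : ∃ c, a + b - i = c + 1 := ⟨a + b - i - 1, by omega⟩
    rw [hc] at h ⊢
    rw [show a + b - (i + 1) = c by omega]
    rw [pow_succ, pow_succ]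
    linear_combination a ^ i * a * b ^ c * b * h
  have hdown : ∀ t ≤ a, a ^ (a - t) * b ^ (a + b - (a - t)) * (a + b).choose (a - t) ≤
      a ^ a * b ^ (a + b - a) * (a + b).choose a := by
    intro t
    induction t with
    | zero => simp
    | succ t ih =>
      intro ht
      refine le_trans ?_ (ih (by omega))
      have h := key (a - (t + 1)) (by omega)
      rw [show a - (t + 1) + 1 = a - t by omega] at h
      refine Nat.le_of_mul_le_mul_right (c := (a - t) * b) ?_ (Nat.mul_pos (by omega) hb)
      rw [h]
      refine Nat.mul_le_mul_left _ ?_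
      rw [mul_comm (a - t)]
      exact Nat.mul_le_mul (by omega) (by omega)
  have hup : ∀ t ≤ b, a ^ (a + t) * b ^ (a + b - (a + t)) * (a + b).choose (a + t) ≤
      a ^ a * b ^ (a + b - a) * (a + b).choose a := by
    intro t
    induction t with
    | zero => simp
    | succ t ih =>
      intro ht
      refine le_trans ?_ (ih (by omega))
      have h := key (a + t) (by omega)
      refine Nat.le_of_mul_le_mul_right (c := (a + t + 1) * b) ?_ (Nat.mul_pos (by omega) hb)
      rw [← add_assoc, h]
      refine Nat.mul_le_mul_left _ ?_
      rw [mul_comm (a + t + 1)]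
      exact Nat.mul_le_mul (by omega) (by omega)
  rw [Nat.add_sub_cancel_left] at hdown hup
  rcases le_total i a with h | h
  · have := hdown (a - i) (by omega)
    rwa [Nat.sub_sub_self h] at this
  · have := hup (i - a) (by omega)
    rwa [Nat.add_sub_cancel' h] at this

theorem add_pow_le_succ_mul_choose (a : ℕ) {b : ℕ} (hb : 0 < b) :
    (a + b) ^ (a + b) ≤ (a + b + 1) * (a ^ a * b ^ b * (a + b).choose a) := by
  rw [add_pow]
  refine (sum_le_card_nsmul _ _ (a ^ a * b ^ b * (a + b).choose a) fun i hi => ?_).trans_eq ?_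
  · exact choose_mul_pow_le_choose_mul_pow hb (Nat.lt_succ_iff.1 (mem_range.1 hi))
  · rw [card_range, smul_eq_mul]

theorem log_choose_ge {N k : ℕ} (hk : 0 < k) (hkN : k < N) :
    k * (Real.log N - Real.log k) + k - (k : ℝ) ^ 2 / N - Real.log (N + 1) ≤
      Real.log (N.choose k) := by
  obtain ⟨b, rfl⟩ := Nat.exists_eq_add_of_le hkN.le
  have hb : 0 < b := by omega
  have h := add_pow_le_succ_mul_choose k hb
  have hC : 0 < (k + b).choose k := Nat.choose_pos (by omega)
  have hk' : (0 : ℝ) < k := by exact_mod_cast hk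
  have hb' : (0 : ℝ) < b := by exact_mod_cast hb
  have hC' : (0 : ℝ) < (k + b).choose k := by exact_mod_cast hC
  have h1 : ((k : ℝ) + b) ^ (k + b) ≤
      (k + b + 1) * ((k : ℝ) ^ k * (b : ℝ) ^ b * (k + b).choose k) := by exact_mod_cast h
  have h2 := Real.log_le_log (by positivity) h1
  rw [Real.log_mul (by positivity) (by positivity), Real.log_mul (by positivity) (by positivity),
    Real.log_mul (by positivity) (by positivity), Real.log_pow, Real.log_pow, Real.log_pow] at h2
  have h3 := Real.log_le_sub_one_of_pos (show (0 : ℝ) < b / (k + b) by positivity)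
  rw [Real.log_div (by positivity) (by positivity)] at h3
  have h4 : (b : ℝ) / (k + b) - 1 = - (k / (k + b)) := by
    field_simp
    ring
  have h5 : (b : ℝ) * (k / (k + b)) = k - (k : ℝ) ^ 2 / (k + b) := by
    field_simp
    ring
  have h6 := mul_le_mul_of_nonneg_left h3 hb'.le
  rw [h4, mul_neg, h5] at h6
  push_cast at h2 ⊢
  linarith

theorem le_mul_log_of_pow_le {q : ℝ} {a b : ℕ} (h : (2.7182818286 : ℝ) ^ a ≤ q ^ b) :
    a ≤ b * Real.log q := by
  have h1 : Real.exp 1 ^ a ≤ q ^ b :=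
    (pow_le_pow_left₀ (Real.exp_pos 1).le Real.exp_one_lt_d9.le a).trans h
  have h2 := Real.log_le_log (pow_pos (Real.exp_pos 1) a) h1
  rwa [Real.log_pow, Real.log_exp, mul_one, Real.log_pow] at h2

theorem mul_log_le_of_pow_le {q : ℝ} {a b : ℕ} (hq : 0 < q)
    (h : q ^ b ≤ (2.7182818283 : ℝ) ^ a) : b * Real.log q ≤ a := by
  have h1 : q ^ b ≤ Real.exp 1 ^ a :=
    h.trans (pow_le_pow_left₀ (by norm_num) Real.exp_one_gt_d9.le a)
  have h2 := Real.log_le_log (pow_pos hq b) h1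
  rwa [Real.log_pow, Real.log_pow, Real.log_exp, mul_one] at h2

theorem log_primorial_le (y : ℕ) :
    Real.log (primorial y) ≤ ((y : ℝ) / 42 + 1) * 46.8 := by
  have h : ((primorial y : ℕ) : ℝ) ≤ (4 * (2 ^ 22 * 3 ^ 15 * 7 ^ 7)) ^ (y / 42 + 1) := by
    exact_mod_cast primorial_le_pow y
  have h0 : (0 : ℝ) < primorial y := by exact_mod_cast primorial_pos y
  have h1 := Real.log_le_log h0 h
  rw [Real.log_pow] at h1
  have h2 := mul_log_le_of_pow_le (q := 4 * (2 ^ 22 * 3 ^ 15 * 7 ^ 7)) (a := 234) (b := 5)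
    (by norm_num) (by norm_num)
  have h3 : ((y / 42 : ℕ) : ℝ) ≤ y / 42 := Nat.cast_div_le
  have h4 : (0 : ℝ) ≤ (y / 42 : ℕ) := Nat.cast_nonneg _
  push_cast at h1 h2
  set q := Real.log (4 * (2 ^ 22 * 3 ^ 15 * 7 ^ 7))
  have h5 : (((y / 42 : ℕ) : ℝ) + 1) * q ≤ ((y / 42 : ℕ) + 1) * 46.8 :=
    mul_le_mul_of_nonneg_left (by linarith) (by linarith)
  linarith

theorem log_add_one_le {N : ℕ} (hN : 1000 ≤ N) :
    Real.log ((N : ℝ) + 1) ≤ Real.log N + 1 / 1000 := by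
  have hN' : (1000 : ℝ) ≤ N := by exact_mod_cast hN
  have h := Real.log_le_sub_one_of_pos (show (0 : ℝ) < ((N : ℝ) + 1) / N by positivity)
  rw [Real.log_div (by positivity) (by positivity)] at h
  have h1 : ((N : ℝ) + 1) / N - 1 ≤ 1 / 1000 := by
    rw [add_div, div_self (by positivity), add_sub_cancel_left]
    exact one_div_le_one_div_of_le (by norm_num) hN'
  linarith

theorem log_choose_le_of_forall_lt {N d e k y : ℕ} (hkN : k ≤ N) (hN : 0 < N)
    (hy : ∀ p, p.Prime → y < p → p < d → ¬ p ∣ N.choose k)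
    (bad : ∀ p r, p.Prime → r < k → r ≠ e → p ∣ N - r → p < d) :
    Real.log (N.choose k) ≤
      (11 + 4 / 15 * (√N + 1)) * Real.log N + ((y : ℝ) / 42 + 1) * 46.8 := by
  have h := choose_le_pow_card_mul_primorial hkN hN (s := Nat.sqrt N + 1)
    (by rw [sq]; exact Nat.lt_succ_sqrt N) hy bad
  have hC : (0 : ℝ) < N.choose k := by exact_mod_cast Nat.choose_pos hkN
  have hN1 : (1 : ℝ) ≤ N := by exact_mod_cast hN
  have hP : (0 : ℝ) < primorial y := by exact_mod_cast primorial_pos y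
  have h1 : (N.choose k : ℝ) ≤ (N : ℝ) ^ ((Nat.sqrt N + 1).primesBelow.card + 1) * primorial y := by
    exact_mod_cast h
  have h2 := Real.log_le_log hC h1
  rw [Real.log_mul (by positivity) hP.ne', Real.log_pow] at h2
  have h3 : (15 : ℝ) * (Nat.sqrt N + 1).primesBelow.card ≤ 150 + 4 * (Nat.sqrt N + 1) := by
    exact_mod_cast card_primesBelow_le (Nat.sqrt N + 1)
  have h4 : (Nat.sqrt N : ℝ) ≤ √N := Real.nat_sqrt_le_real_sqrt
  have h5 := log_primorial_le y
  have h6 : ((Nat.sqrt N + 1).primesBelow.card : ℝ) + 1 ≤ 11 + 4 / 15 * (√N + 1) := by linarith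
  have h7 := mul_le_mul_of_nonneg_right h6 (Real.log_nonneg hN1)
  push_cast at h2
  linarith

theorem pos_of_mem_Icc {A B D x₁ x₂ x : ℝ} (hA : 0 ≤ A) (hB : 0 ≤ B) (hx₁ : 0 < x₁)
    (h₁ : 0 < A * Real.log x₁ - B * (x₁ * Real.log x₁) - D)
    (h₂ : 0 < A * Real.log x₂ - B * (x₂ * Real.log x₂) - D) (hx : x ∈ Set.Icc x₁ x₂) :
    0 < A * Real.log x - B * (x * Real.log x) - D := by
  have hlog : ConcaveOn ℝ (Set.Ioi 0) fun x => A * Real.log x :=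
    strictConcaveOn_log_Ioi.concaveOn.smul hA
  have hmul : ConvexOn ℝ (Set.Ioi 0) fun x => B * (x * Real.log x) :=
    (Real.convexOn_mul_log.subset Set.Ioi_subset_Ici_self (convex_Ioi 0)).smul hB
  have h := (hlog.sub hmul).min_le_of_mem_Icc (x := x₁) (y := x₂) hx₁
    (hx₁.trans_le (hx.1.trans hx.2)) hx
  exact sub_pos.2 ((lt_min (sub_pos.1 h₁) (sub_pos.1 h₂)).trans_le h)

theorem log_three_mul_le {j : ℝ} (hj : 0 < j) : Real.log (3 * j) ≤ 1.1 + Real.log j := by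
  have h := mul_log_le_of_pow_le (q := 3) (a := 11) (b := 10) (by norm_num) (by norm_num)
  push_cast at h
  rw [Real.log_mul (by norm_num) hj.ne']
  linarith

theorem five_le_log {j : ℝ} (hj : 200 ≤ j) : 5 ≤ Real.log j := by
  have h := le_mul_log_of_pow_le (q := 200) (a := 5) (b := 1) (by norm_num)
  push_cast at h
  have h1 := Real.log_le_log (by norm_num) hj
  linarith

theorem not_forall_lt_of_sq_le {N W d e : ℕ} (hd : 1000 ≤ d) (hNd : 25 * (d / 5) ^ 2 ≤ 4 * N)
    (hW : 271 * d + 200 ≤ 442 * W)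
    (bad : ∀ p r, p.Prime → r ≤ W → r ≠ e → p ∣ N - r → p < d + 4) : False := by
  obtain ⟨j, hj⟩ : ∃ j, j = d / 5 := ⟨_, rfl⟩
  have hj5 : 5 * j ≤ d := by omega
  have hjN : 25 * j ^ 2 ≤ 4 * N := hj ▸ hNd
  have hj200 : 200 ≤ j := by omega
  have hjN' : 1250 * j ≤ N := by nlinarith
  have hC := choose_le_pow_card (N := N) (d := d + 4) (e := e) (k := 3 * j) (by omega) (by omega)
    fun p r hp hr => bad p r hp (by omega)
  have hlow := log_choose_ge (N := N) (k := 3 * j) (by omega) (by omega)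
  have hC0 : (0 : ℝ) < N.choose (3 * j) := by
    exact_mod_cast Nat.choose_pos (by omega)
  have hN1 := log_add_one_le (N := N) (by omega)
  have hcard : (15 : ℝ) * (d + 4).primesBelow.card ≤ 20 * j + 182 := by
    have := card_primesBelow_le (d + 4)
    exact_mod_cast (by omega : 15 * (d + 4).primesBelow.card ≤ 20 * j + 182)
  have hC' : (N.choose (3 * j) : ℝ) ≤ (N : ℝ) ^ ((d + 4).primesBelow.card + 1) := by
    exact_mod_cast hC
  have hup := Real.log_le_log hC0 hC'
  rw [Real.log_pow] at hup
  have hJ : (200 : ℝ) ≤ j := by exact_mod_cast hj200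
  have hJN : 25 * (j : ℝ) ^ 2 ≤ 4 * N := by exact_mod_cast hjN
  have hNpos : (0 : ℝ) < N := by nlinarith
  have hL := five_le_log hJ
  have h3 := log_three_mul_le (by linarith : (0 : ℝ) < j)
  have hM : 2 * Real.log j + 1.8 ≤ Real.log N := by
    have h1 := Real.log_le_log (by positivity) (show ((5 / 2 * j : ℝ)) ^ 2 ≤ N by nlinarith)
    rw [Real.log_pow, Real.log_mul (by norm_num) (by linarith)] at h1
    have h2 := le_mul_log_of_pow_le (q := 5 / 2) (a := 9) (b := 10) (by norm_num)
    push_cast at h1 h2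
    linarith
  have hquot : ((3 * j : ℝ)) ^ 2 / N ≤ 1.44 := by
    rw [div_le_iff₀ hNpos]
    nlinarith
  push_cast at hlow hup
  set L := Real.log j
  set M := Real.log N
  have h4 : (((d + 4).primesBelow.card : ℝ) + 1) * M ≤ (4 / 3 * j + 13.14) * M :=
    mul_le_mul_of_nonneg_right (by linarith) (by linarith)
  have h5 : 0 ≤ (3 * j : ℝ) * (1.1 + L - Real.log (3 * j)) :=
    mul_nonneg (by linarith) (by linarith)
  have h6 : 0 ≤ (5 / 3 * (j : ℝ) - 14.14) * (M - (2 * L + 1.8)) :=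
    mul_nonneg (by linarith) (by linarith)
  have h7 : 0 ≤ (1 / 3 * (j : ℝ) - 28.28) * (L - 5) := mul_nonneg (by linarith) (by linarith)
  linarith

/-- The difference between the logarithmic lower and upper bounds for `N.choose (3 * j)`, as a
function of `x = √N`, is positive on `[√(20 * j), 5 / 2 * j]`. -/
theorem bound_pos_of_mem_Icc {j x : ℝ} (hj : 200 ≤ j) (hx : x ∈ Set.Icc √(20 * j) (5 / 2 * j)) :
    0 < (6 * j - 368 / 15) * Real.log x - 8 / 15 * (x * Real.log x) -
      (3 * j * Real.log (3 * j) + 3.0215 * j + 54.61) := by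
  have hj0 : 0 < j := by linarith
  have hL := five_le_log hj
  have h3 := log_three_mul_le hj0
  refine pos_of_mem_Icc (by linarith) (by norm_num) (Real.sqrt_pos.2 (by linarith)) ?_ ?_ hx
  · rw [Real.log_sqrt (by linarith)]
    have hz0 := Real.sqrt_pos.2 hj0
    have hz : 14.14 ≤ √j := Real.le_sqrt_of_sq_le (by linarith)
    have hzz := Real.sq_sqrt hj0.le
    have hlow := le_mul_log_of_pow_le (q := 20 / 3) (a := 189) (b := 100) (by norm_num)
    have h20 := mul_log_le_of_pow_le (q := 20) (a := 3) (b := 1) (by norm_num) (by norm_num)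
    have h14 := mul_log_le_of_pow_le (q := 14) (a := 132) (b := 50) (by norm_num) (by norm_num)
    have hlogz := Real.log_le_sub_one_of_pos (show 0 < √j / 14 by positivity)
    rw [Real.log_div hz0.ne' (by norm_num), Real.log_sqrt hj0.le] at hlogz
    have hs : √(20 * j) ≤ 4.4722 * √j := by
      rw [Real.sqrt_mul (by norm_num)]
      exact mul_le_mul_of_nonneg_right (Real.sqrt_le_iff.2 (by norm_num)) hz0.le
    have e20 : Real.log (20 * j) = Real.log 20 + Real.log j :=
      Real.log_mul (by norm_num) hj0.ne'
    have e3 : Real.log (3 * j) = Real.log 3 + Real.log j := Real.log_mul (by norm_num) hj0.ne'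
    rw [Real.log_div (by norm_num) (by norm_num)] at hlow
    push_cast at hlow h20 h14
    have ha : 0 ≤ Real.log 20 := Real.log_nonneg (by norm_num)
    rw [e3, e20]
    set z := √j
    set s := √(20 * j)
    set L := Real.log j
    set a := Real.log 20
    have hM : a + L ≤ 6.28 + z / 7 := by linarith
    have h1 : (184 / 15 + 4 / 15 * s) * (a + L) ≤
        (184 / 15 + 4 / 15 * (4.4722 * z)) * (6.28 + z / 7) :=
      mul_le_mul (by linarith) hM (by linarith) (by linarith)
    have h2 : 0 ≤ j * (100 * (a - Real.log 3) - 189) := mul_nonneg hj0.le (by linarith)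
    nlinarith
  · have h2 := le_mul_log_of_pow_le (q := 5 / 2) (a := 9) (b := 10) (by norm_num)
    rw [Real.log_mul (by norm_num) hj0.ne']
    push_cast at h2
    set L := Real.log j
    set b := Real.log (5 / 2)
    have h5 : 0 ≤ (3 * j : ℝ) * (1.1 + L - Real.log (3 * j)) :=
      mul_nonneg (by linarith) (by linarith)
    have h6 : 0 ≤ (14 / 3 * j - 368 / 15) * (b - 0.9) := mul_nonneg (by linarith) (by linarith)
    have h7 : 0 ≤ (5 / 3 * j - 368 / 15) * (L - 5) := mul_nonneg (by linarith) (by linarith)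
    linarith

theorem not_forall_lt_of_lt_sq {N W d e : ℕ} (hd : 1000 ≤ d) (hNd : 4 * d ≤ N)
    (hNd' : 4 * N < 25 * (d / 5) ^ 2) (hW : 271 * d + 200 ≤ 442 * W)
    (bad : ∀ p r, p.Prime → r ≤ W → r ≠ e → p ∣ N - r → p < d + 4) : False := by
  obtain ⟨j, hj⟩ : ∃ j, j = d / 5 := ⟨_, rfl⟩
  rw [← hj] at hNd'
  have hup := log_choose_le_of_forall_lt (N := N) (d := d + 4) (e := e) (k := 3 * j)
    (y := 5 * j + 7) (by omega) (by omega) (fun p _ h1 h2 => by omega)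
    fun p r hp hr => bad p r hp (by omega)
  have hlow := log_choose_ge (N := N) (k := 3 * j) (by omega) (by omega)
  have hN1 := log_add_one_le (N := N) (by omega)
  have hJ : (200 : ℝ) ≤ j := by exact_mod_cast (by omega : 200 ≤ j)
  have hN20 : 20 * (j : ℝ) ≤ N := by exact_mod_cast (by omega : 20 * j ≤ N)
  have hN25 : 4 * (N : ℝ) ≤ 25 * (j : ℝ) ^ 2 := by exact_mod_cast hNd'.le
  have hNpos : (0 : ℝ) < N := by linarith
  have hquot : ((3 * j : ℝ)) ^ 2 / N ≤ 0.45 * j := by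
    rw [div_le_iff₀ hNpos]
    nlinarith
  have h := bound_pos_of_mem_Icc (x := √N) hJ ⟨Real.sqrt_le_sqrt hN20, by
    rw [Real.sqrt_le_left (by linarith)]
    linarith⟩
  rw [Real.log_sqrt hNpos.le] at h
  push_cast at hlow hup
  linarith

theorem log_const_mul_le {j : ℕ} (hj : 0 < j) :
    6.1 * j ≤ Real.log (10 * j + 1) + Real.log ((10 * j).choose (3 * j)) := by
  have h := add_pow_le_succ_mul_choose (3 * j) (b := 7 * j) (by omega)
  rw [show 3 * j + 7 * j = 10 * j by ring] at h
  have hj' : (0 : ℝ) < j := by exact_mod_cast hj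
  have hC : (0 : ℝ) < (10 * j).choose (3 * j) := by exact_mod_cast Nat.choose_pos (by omega)
  have h1 : (10 * j : ℝ) ^ (10 * j) ≤ (10 * j + 1) *
      ((3 * j : ℝ) ^ (3 * j) * (7 * j : ℝ) ^ (7 * j) * (10 * j).choose (3 * j)) := by
    exact_mod_cast h
  have h2 := Real.log_le_log (by positivity) h1
  rw [Real.log_mul (by positivity) (by positivity), Real.log_mul (by positivity) (by positivity),
    Real.log_mul (by positivity) (by positivity), Real.log_pow, Real.log_pow, Real.log_pow,
    Real.log_mul (by norm_num) hj'.ne', Real.log_mul (by norm_num) hj'.ne',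
    Real.log_mul (by norm_num) hj'.ne'] at h2
  have h3 := le_mul_log_of_pow_le (q := 10 ^ 10 / (3 ^ 3 * 7 ^ 7)) (a := 61) (b := 10)
    (by norm_num)
  rw [Real.log_div (by norm_num) (by norm_num), Real.log_mul (by norm_num) (by norm_num),
    Real.log_pow, Real.log_pow, Real.log_pow] at h3
  push_cast at h2 h3
  have h4 := mul_le_mul_of_nonneg_left h3 hj'.le
  linarith

theorem not_dvd_choose {N k p : ℕ} (hp : p.Prime) (h : N < 2 * p) (hk : p + k ≤ N) :
    ¬ p ∣ N.choose k := by
  intro hd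
  have h1 : p ∣ N.descFactorial k := by
    rw [Nat.descFactorial_eq_factorial_mul_choose]
    exact hd.mul_left _
  rw [Nat.descFactorial_eq_prod_range, hp.prime.dvd_finsetProd_iff] at h1
  obtain ⟨i, hi, c, hc⟩ := h1
  rw [mem_range] at hi
  rcases c with _ | _ | c
  · omega
  · omega
  · nlinarith [Nat.sub_le N i]

theorem not_forall_lt_of_forty_thousand_le {N W d e : ℕ} (hN : 40000 ≤ N) (hNd : N < 4 * d)
    (hW : 271 * d + 200 ≤ 442 * W) (hNW : d + W + 1 ≤ N)
    (bad : ∀ p r, p.Prime → r ≤ W → r ≠ e → p ∣ N - r → p < d + 4) : False := by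
  obtain ⟨y, hy⟩ : ∃ y, y = min (N / 2) d := ⟨_, rfl⟩
  obtain ⟨j, hj⟩ : ∃ j, j = y / 5 := ⟨_, rfl⟩
  have hup := log_choose_le_of_forall_lt (N := N) (d := d + 4) (e := e) (k := 3 * j)
    (y := 5 * j + 7) (by omega) (by omega)
    (fun p hp h1 h2 => not_dvd_choose hp (by omega) (by omega))
    fun p r hp hr => bad p r hp (by omega)
  have hlow := log_const_mul_le (j := j) (by omega)
  have hN1 := log_add_one_le (N := N) (by omega)
  have hJ : (2000 : ℝ) ≤ j := by exact_mod_cast (by omega : 2000 ≤ j)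
  have hj0 : (0 : ℝ) < j := by linarith
  have hN20 : (N : ℝ) ≤ 20.01 * j := by
    have : (N : ℝ) ≤ 20 * j + 16 := by exact_mod_cast (by omega : N ≤ 20 * j + 16)
    linarith
  have hN0 : (40000 : ℝ) ≤ N := by exact_mod_cast hN
  have hC := Real.log_le_log
    (by exact_mod_cast Nat.choose_pos (by omega) : (0 : ℝ) < (10 * j).choose (3 * j))
    (by exact_mod_cast Nat.choose_le_choose (3 * j) (by omega : 10 * j ≤ N) :
      ((10 * j).choose (3 * j) : ℝ) ≤ N.choose (3 * j))
  have h10 := Real.log_le_log (by positivity)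
    (by exact_mod_cast (by omega : 10 * j + 1 ≤ N + 1) : 10 * (j : ℝ) + 1 ≤ N + 1)
  have hz0 := Real.sqrt_pos.2 hj0
  have hz : 44.7 ≤ √(j : ℝ) := Real.le_sqrt_of_sq_le (by linarith)
  have hzz := Real.sq_sqrt hj0.le
  have h20 := mul_log_le_of_pow_le (q := 20.01) (a := 3) (b := 1) (by norm_num) (by norm_num)
  have h45 := mul_log_le_of_pow_le (q := 45) (a := 80) (b := 21) (by norm_num) (by norm_num)
  have hlogz := Real.log_le_sub_one_of_pos (show 0 < √(j : ℝ) / 45 by positivity)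
  rw [Real.log_div hz0.ne' (by norm_num), Real.log_sqrt hj0.le] at hlogz
  have hM := Real.log_le_log (by linarith) hN20
  rw [Real.log_mul (by norm_num) hj0.ne'] at hM
  have hM0 : 0 ≤ Real.log N := Real.log_nonneg (by linarith)
  have hs : √(N : ℝ) ≤ 4.474 * √j := by
    refine (Real.sqrt_le_sqrt hN20).trans ?_
    rw [Real.sqrt_mul (by norm_num)]
    exact mul_le_mul_of_nonneg_right (Real.sqrt_le_iff.2 (by norm_num)) hz0.le
  push_cast at hup h20 h45
  set z := √(j : ℝ)
  set s := √(N : ℝ)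
  set M := Real.log N
  have hs0 : 0 ≤ s := Real.sqrt_nonneg _
  have hMz : M ≤ 8.63 + 2 / 45 * z := by linarith
  have h1 : (184 / 15 + 4 / 15 * s) * M ≤
      (184 / 15 + 4 / 15 * (4.474 * z)) * (8.63 + 2 / 45 * z) :=
    mul_le_mul (by linarith) hMz hM0 (by linarith)
  nlinarith

theorem exists_prime_dvd_sub {N W d : ℕ} (e : ℕ) (hN : 1001 ≤ N) (hd : 6 ≤ d)
    (hW : 271 * d + 200 ≤ 442 * W) (hW' : 442 * W < 271 * d + 642) (hNW : d + W + 1 ≤ N) :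
    ∃ p r, p.Prime ∧ r ≤ W ∧ r ≠ e ∧ p ∣ N - r ∧ d + 4 ≤ p := by
  by_contra! h
  have bad : ∀ p r, p.Prime → r ≤ W → r ≠ e → p ∣ N - r → p < d + 4 :=
    fun p r hp hr hre hd => h p r hp hr hre hd
  rcases le_or_gt d 12 with h12 | h12
  · exact not_forall_lt_of_le_twelve (by omega) hd h12 hW hW' bad
  rcases lt_or_ge N (4 * d) with hNd | hNd
  · rcases le_total N 40000 with h4 | h4
    · exact not_forall_lt_of_lt_four_mul hN h4 hNd hW hNW bad
    · exact not_forall_lt_of_forty_thousand_le h4 hNd hW hNW bad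
  rcases le_total d 1000 with h1 | h1
  · exact not_forall_lt_of_le_thousand hN hNd h12 h1 hW bad
  rcases lt_or_ge (4 * N) (25 * (d / 5) ^ 2) with hs | hs
  · exact not_forall_lt_of_lt_sq h1 hNd hs hW bad
  · exact not_forall_lt_of_sq_le h1 hs hW bad

theorem mod_eq_of_dvd_sub {N p r : ℕ} (hrN : r ≤ N) (hrp : r < p) (h : p ∣ N - r) :
    N % p = r := by
  obtain ⟨c, hc⟩ := h
  rw [show N = r + p * c by omega, Nat.add_mul_mod_self_left, Nat.mod_eq_of_lt hrp]

theorem not_dvd_sub_of_dvd_sub {N p r m : ℕ} (hrN : r ≤ N) (hrp : r < p) (hmp : m < p)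
    (hrm : r ≠ m) (h : p ∣ N - r) : ¬ (p : ℤ) ∣ (N : ℤ) - m := by
  intro h'
  have h1 : (p : ℤ) ∣ (N : ℤ) - r := by
    have := Int.natCast_dvd_natCast.mpr h
    rwa [Nat.cast_sub hrN] at this
  have h2 : (p : ℤ) ∣ (r : ℤ) - m := by
    have := dvd_sub h' h1
    rwa [show (N : ℤ) - m - (N - r) = r - m by ring] at this
  have h3 := Int.eq_zero_of_abs_lt_dvd h2 (by rw [abs_lt]; constructor <;> omega)
  omega

theorem false_of_prime_dvd_sub {m N d p r : ℕ} (hm : 1 ≤ m) (hmN : m < N) (hp : p.Prime)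
    (hd : 1 ≤ d) (hp5 : 5 ≤ p) (hmp : m < p)
    (hpd : d + 4 ≤ p ∨ (d ≤ p ∧ m % 2 = 1 ∧ N % 2 = 0))
    (hrN : r ≤ N) (hrp : r < p) (hrm : r ≠ m) (hrd : r + m ≤ d) (hdvd : p ∣ N - r)
    {HeL RL g : Polynomial ℤ} (hA : C ((N : ℤ) - m) * HeL = pairWr m N)
    (hR : HeL = X ^ pairOrder m N * RL) (hR0 : RL.coeff 0 ≠ 0)
    (hgd : g.natDegree = d) (hg : g ∣ RL) : False :=
  false_of_prime hm hmN hp hd hp5 hmp hpd (not_dvd_sub_of_dvd_sub hrN hrp hmp hrm hdvd)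
    (by rwa [mod_eq_of_dvd_sub hrN hrp hdvd]) hA hR hR0 hgd hg

theorem false_of_factor_of_le_five {N d : ℕ} (hN : 1001 ≤ N) (hd4 : 4 ≤ d) (hd5 : d ≤ 5)
    {HeL RL g : Polynomial ℤ} (hA : C ((N : ℤ) - (1 : ℕ)) * HeL = pairWr 1 N)
    (hR : HeL = X ^ pairOrder 1 N * RL) (hR0 : RL.coeff 0 ≠ 0)
    (hgd : g.natDegree = d) (hg : g ∣ RL) : False := by
  rcases Nat.mod_two_eq_zero_or_one N with hpar | hpar
  · refine false_of_even (N := N) (by omega) hpar fun p hp h => ?_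
    by_contra! hp5
    have key : ∀ r, r ≤ 3 → r ≠ 1 → p ∣ N - r → False := fun r hr hr1 hdvd =>
      false_of_prime_dvd_sub le_rfl (by omega) hp (by omega) hp5 (by omega)
        (Or.inr ⟨by omega, rfl, hpar⟩) (by omega) (by omega) hr1 (by omega) hdvd
        hA hR hR0 hgd hg
    rcases h with h | h | h
    · exact key 0 (by omega) (by omega) h
    · exact key 2 (by omega) (by omega) h
    · exact key 3 (by omega) (by omega) h
  · refine false_of_odd (N := N) (by omega) hpar (fun p hp h => ?_) fun p hp h => ?_
    · by_contra! hp11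
      have key : ∀ r, r ≤ 3 → r ≠ 1 → p ∣ N - r → False := fun r hr hr1 hdvd =>
        false_of_prime_dvd_sub le_rfl (by omega) hp (by omega) (by omega) (by omega)
          (Or.inl (by omega)) (by omega) (by omega) hr1 (by omega) hdvd hA hR hR0 hgd hg
      rcases h with h | h
      · exact key 0 (by omega) (by omega) h
      · exact key 2 (by omega) (by omega) h
    · by_contra! hp5
      rw [Nat.cast_one] at hA
      exact false_of_prime_of_dvd_sub_three (by omega) hpar hp hp5 hd4 hd5 h hA hR hR0 hgd hg

theorem false_of_factor_of_six_le {m N d : ℕ} (hm : 1 ≤ m) (hmN : m < N) (hN : 1001 ≤ N)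
    (hd : 6 ≤ d) (hmd : 442 * m + 200 ≤ 171 * d) (hdN : 2 * d + 1 ≤ N + m)
    {HeL RL g : Polynomial ℤ} (hA : C ((N : ℤ) - m) * HeL = pairWr m N)
    (hR : HeL = X ^ pairOrder m N * RL) (hR0 : RL.coeff 0 ≠ 0)
    (hgd : g.natDegree = d) (hg : g ∣ RL) : False := by
  obtain ⟨W, hW, hW'⟩ : ∃ W, 271 * d + 200 ≤ 442 * W ∧ 442 * W < 271 * d + 642 :=
    ⟨(271 * d + 641) / 442, by omega, by omega⟩
  obtain ⟨p, r, hp, hrW, hrm, hdvd, hdp⟩ :=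
    exists_prime_dvd_sub m hN hd hW hW' (by omega)
  exact false_of_prime_dvd_sub hm hmN hp (by omega) (by omega) (by omega) (Or.inl hdp)
    (by omega) (by omega) hrm (by omega) hdvd hA hR hR0 hgd hg

/-- Lemma `lem:high_degree_for_nm`.  Let `m ≥ 1` and
`d(m) = ⌈(8.84m + 4)/3.42⌉ = ⌈(442m + 200)/171⌉`.  If `n ≥ max{m, 1000}` and
`λ = (n, m)`, then `R_λ` has no factor in `ℤ[X]` of degree `d` for any
`d(m) ≤ d ≤ (n + m - s_λ)/2`. -/
theorem stmt11 (m : ℕ) (hm : 1 ≤ m) (n : ℕ) (hn : max m 1000 ≤ n)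
    (HeL RL : Polynomial ℤ)
    (hHe : Polynomial.C (vand (degSeq ![n, m])) * HeL = wronskHe (degSeq ![n, m]))
    (hR : HeL = Polynomial.X ^ sStat (degSeq ![n, m]) * RL)
    (hR0 : RL.coeff 0 ≠ 0) :
    ∀ d : ℕ, (442 * m + 200 + 170) / 171 ≤ d →
      2 * d ≤ n + m - sStat (degSeq ![n, m]) →
      ¬ ∃ g : Polynomial ℤ, g.natDegree = d ∧ g ∣ RL := by
  intro d hd hdn ⟨g, hgd, hg⟩
  rw [vand_degSeq_pair, wronskHe_degSeq_pair] at hHe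
  rw [sStat_degSeq_pair] at hR
  have hd' : 2 * d ≤ n + m := hdn.trans (Nat.sub_le _ _)
  rcases lt_or_ge d 6 with h6 | h6
  · obtain rfl : m = 1 := by omega
    exact false_of_factor_of_le_five (by omega) (by omega) (by omega) hHe hR hR0 hgd hg
  · exact false_of_factor_of_six_le hm (by omega) (by omega) h6 (by omega) (by omega)
      hHe hR hR0 hgd hg
end

section
/- Let n ≥ 1000 be an integer such that n + 1 is a perfect square. Then R_{n,n}(x) has no factor of degree d in ℤ[x] for any d with 1 ≤ d ≤ 10. -/
open Polynomial Finset

theorem He_succ_eq_sub_derivative (n : ℕ) :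
    He (n + 1) = X * He n - derivative (He n) ∧
      derivative (He (n + 1)) = C ((n : ℤ) + 1) * He n := by
  induction n with
  | zero => simp [He]
  | succ n ih =>
    have h1 : He (n + 2) = X * He (n + 1) - derivative (He (n + 1)) := by
      rw [ih.2]; simp [He]
    refine ⟨h1, ?_⟩
    have h2 := congrArg derivative ih.1
    rw [show He (n + 1 + 1) = X * He (n + 1) - C ((n : ℤ) + 1) * He n from rfl]
    simp only [derivative_sub, derivative_mul, derivative_X, derivative_C] at *
    rw [ih.2, ih.1]
    simp only [Nat.cast_add, Nat.cast_one, map_add, map_one]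
    ring

/-- If polynomials solve a first-order linear system with polynomial coefficients, a common divisor
of their values at `0` divides all their derivatives at `0`. -/
theorem dvd_factorial_mul_coeff {a b c e : ℤ[X]} {s t M : ℤ}
    (ha : derivative a = b + c) (hb : derivative b = e + X * b - C s * a)
    (hc : derivative c = e + X * c - C t * a)
    (he : derivative e = 2 * (X * e) - C t * b - C s * c)
    (ha0 : M ∣ a.coeff 0) (hb0 : M ∣ b.coeff 0) (hc0 : M ∣ c.coeff 0) (he0 : M ∣ e.coeff 0)
    (k : ℕ) :
    M ∣ (k.factorial : ℤ) * a.coeff k ∧ M ∣ (k.factorial : ℤ) * b.coeff k ∧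
      M ∣ (k.factorial : ℤ) * c.coeff k ∧ M ∣ (k.factorial : ℤ) * e.coeff k := by
  have hX : ∀ (q : ℤ[X]) (k : ℕ), (∀ j < k, M ∣ (j.factorial : ℤ) * q.coeff j) →
      M ∣ (k.factorial : ℤ) * (X * q).coeff k := by
    intro q k h
    cases k with
    | zero => simp
    | succ j =>
      rw [coeff_X_mul, Nat.factorial_succ]
      push_cast
      rw [mul_assoc]
      exact (h j j.lt_succ_self).mul_left _
  have hD : ∀ (q : ℤ[X]) (k : ℕ), ((k + 1).factorial : ℤ) * q.coeff (k + 1) =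
      (k.factorial : ℤ) * (derivative q).coeff k := by
    intro q k
    rw [coeff_derivative, Nat.factorial_succ]
    push_cast
    ring
  induction k using Nat.strong_induction_on with
  | _ k ih =>
    cases k with
    | zero => simpa using ⟨ha0, hb0, hc0, he0⟩
    | succ k =>
      obtain ⟨ia, ib, ic, ie⟩ := ih k k.lt_succ_self
      have hlt : ∀ j < k, j < k + 1 := fun j hj => hj.trans k.lt_succ_self
      have hXb := hX b k fun j hj => (ih j (hlt j hj)).2.1
      have hXc := hX c k fun j hj => (ih j (hlt j hj)).2.2.1
      have hXe := hX e k fun j hj => (ih j (hlt j hj)).2.2.2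
      simp only [hD, ha, hb, hc, he]
      refine ⟨?_, ?_, ?_, ?_⟩
      · rw [coeff_add, mul_add]
        exact dvd_add ib ic
      · rw [coeff_sub, coeff_add, coeff_C_mul, mul_sub, mul_add, mul_left_comm]
        exact dvd_sub (dvd_add ie hXb) (ia.mul_left _)
      · rw [coeff_sub, coeff_add, coeff_C_mul, mul_sub, mul_add, mul_left_comm]
        exact dvd_sub (dvd_add ie hXc) (ia.mul_left _)
      · rw [coeff_sub, coeff_sub, coeff_C_mul, coeff_C_mul, two_mul, coeff_add, mul_sub, mul_sub,
          mul_add, mul_left_comm _ t, mul_left_comm _ s]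
        exact dvd_sub (dvd_sub (dvd_add hXe hXe) (ib.mul_left _)) (ic.mul_left _)

/-- The Wronskian of two consecutive Hermite polynomials. -/
noncomputable def wronskConsecutive (n : ℕ) : ℤ[X] :=
  He n * derivative (He (n + 1)) - derivative (He n) * He (n + 1)

theorem coeff_zero_dvd_factorial_mul_coeff_wronskConsecutive (n k : ℕ) :
    (wronskConsecutive n).coeff 0 ∣ (k.factorial : ℤ) * (wronskConsecutive n).coeff k := by
  have hode : ∀ m : ℕ, derivative (derivative (He m)) = X * derivative (He m) - C (m : ℤ) * He m := by
    intro m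
    have h1 := congrArg derivative (He_succ_eq_sub_derivative m).1
    rw [(He_succ_eq_sub_derivative m).2] at h1
    simp only [derivative_sub, derivative_mul, derivative_X, map_add, map_one] at h1
    linear_combination h1
  have hy := hode n
  have hz := hode (n + 1)
  have hc : ∀ m j : ℕ, Odd (m + j) → (He m).coeff j = 0 := by
    intro m j h
    rw [He_eq_hermite]
    exact coeff_hermite_of_odd_add h
  have key := dvd_factorial_mul_coeff (a := He n * He (n + 1))
    (b := He n * derivative (He (n + 1))) (c := derivative (He n) * He (n + 1))
    (e := derivative (He n) * derivative (He (n + 1))) (s := ((n + 1 : ℕ) : ℤ)) (t := (n : ℤ))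
    (M := (wronskConsecutive n).coeff 0)
    (by rw [derivative_mul]; ring)
    (by rw [derivative_mul, hz]; ring)
    (by rw [derivative_mul, hy]; ring)
    (by rw [derivative_mul, hy, hz]; ring)
  have hfin : ∀ k, (wronskConsecutive n).coeff k = (He n * derivative (He (n + 1))).coeff k -
      (derivative (He n) * He (n + 1)).coeff k := fun k => coeff_sub _ _ _
  have key2 := fun h1 h2 h3 h4 => key h1 h2 h3 h4 k
  have : (wronskConsecutive n).coeff 0 ∣ (k.factorial : ℤ) * (He n * derivative (He (n + 1))).coeff k
      ∧ (wronskConsecutive n).coeff 0 ∣ (k.factorial : ℤ) * (derivative (He n) * He (n + 1)).coeff k := by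
    rcases Nat.even_or_odd n with h | h
    · have e1 := hc (n + 1) 0 (by grind)
      have e2 := hc n 1 (by grind)
      obtain ⟨-, h2, h3, -⟩ := key2
        (by simp [mul_coeff_zero, e1]) (by simp [hfin, mul_coeff_zero, e1])
        (by simp [mul_coeff_zero, e1]) (by simp [mul_coeff_zero, coeff_derivative, e2])
      exact ⟨h2, h3⟩
    · have e1 := hc n 0 (by grind)
      have e2 := hc (n + 1) 1 (by grind)
      obtain ⟨-, h2, h3, -⟩ := key2
        (by simp [mul_coeff_zero, e1]) (by simp [mul_coeff_zero, e1])
        (by simp [hfin, mul_coeff_zero, e1]) (by simp [mul_coeff_zero, coeff_derivative, e2])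
      exact ⟨h2, h3⟩
  rw [hfin k, mul_sub]
  exact dvd_sub this.1 this.2

theorem monic_He (n : ℕ) : (He n).Monic ∧ (He n).natDegree = n := by
  rw [He_eq_hermite]
  exact ⟨hermite_monic n, natDegree_hermite⟩

theorem wronskConsecutive_monic (n : ℕ) :
    (wronskConsecutive n).Monic ∧ (wronskConsecutive n).natDegree = 2 * n := by
  have hdy : (derivative (He n)).natDegree ≤ n - 1 := by
    simpa only [(monic_He n).2] using natDegree_derivative_le (He n)
  have hdz : (derivative (He (n + 1))).natDegree ≤ n := by
    simpa only [(monic_He (n + 1)).2, Nat.add_sub_cancel] using natDegree_derivative_le (He (n + 1))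
  have hcy : (He n).coeff n = 1 := by
    rw [He_eq_hermite, coeff_hermite_self]
  have hcz : (He (n + 1)).coeff (n + 1) = 1 := by
    rw [He_eq_hermite, coeff_hermite_self]
  have h1 : (He n * derivative (He (n + 1))).natDegree ≤ 2 * n :=
    natDegree_mul_le.trans (by rw [(monic_He n).2]; omega)
  have h2 : (derivative (He n) * He (n + 1)).natDegree ≤ 2 * n := by
    rcases Nat.eq_zero_or_pos n with rfl | hn
    · simp [He]
    · exact natDegree_mul_le.trans (by rw [(monic_He (n + 1)).2]; omega)
  have hdeg : (wronskConsecutive n).natDegree ≤ 2 * n :=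
    (natDegree_sub_le_of_le h1 h2).trans (max_self _).le
  have hcoeff : (wronskConsecutive n).coeff (2 * n) = 1 := by
    have e1 : (He n * derivative (He (n + 1))).coeff (n + n) = n + 1 := by
      rw [coeff_mul_add_eq_of_natDegree_le (monic_He n).2.le hdz, hcy, coeff_derivative, hcz]
      ring
    have e2 : (derivative (He n) * He (n + 1)).coeff (n + n) = n := by
      cases n with
      | zero => simp [He]
      | succ m =>
        rw [show m + 1 + (m + 1) = m + (m + 1 + 1) by omega,
          coeff_mul_add_eq_of_natDegree_le (df := m) hdy (monic_He _).2.le, hcz, coeff_derivative, hcy]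
        push_cast
        ring
    rw [wronskConsecutive, two_mul, coeff_sub, e1, e2]
    ring
  exact ⟨monic_of_natDegree_le_of_coeff_eq_one _ hdeg hcoeff,
    natDegree_eq_of_le_of_coeff_ne_zero hdeg (by simp [hcoeff])⟩

theorem X_pow_dvd_map_He {p N : ℕ} [Fact p.Prime] (hp : p ≠ 2) (hN : p ∣ N) (n : ℕ) (hn : N ≤ n) :
    (X : (ZMod p)[X]) ^ N ∣ (He n).map (Int.castRingHom (ZMod p)) := by
  have hpp : p.Prime := Fact.out
  have hbase : (X : (ZMod p)[X]) ^ N ∣ (He N).map (Int.castRingHom (ZMod p)) := by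
    rw [X_pow_dvd_iff]
    intro i hi
    rw [coeff_map, He_eq_hermite, eq_intCast, ZMod.intCast_zmod_eq_zero_iff_dvd]
    rcases Nat.even_or_odd (N + i) with he | ho
    · obtain ⟨j, rfl⟩ : ∃ j, N = 2 * j + i := ⟨(N - i) / 2, by grind⟩
      rw [coeff_hermite_explicit]
      have hj : 0 < j := by grind
      have h1 : 2 * j * (2 * j + i).choose i =
          (2 * j + i) * (2 * j + i - 1).choose (2 * j - 1) := by
        have := Nat.add_one_mul_choose_eq (2 * j + i - 1) (2 * j - 1)
        rw [Nat.sub_add_cancel (by omega : 1 ≤ 2 * j + i),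
          Nat.sub_add_cancel (by omega : 1 ≤ 2 * j)] at this
        rw [this, mul_comm, Nat.choose_symm_add]
      have h2 : p ∣ 2 * j * (2 * j + i).choose i := h1 ▸ hN.mul_right _
      rcases hpp.dvd_mul.1 h2 with h3 | h3
      · have h4 : p ∣ j := (hpp.dvd_mul.1 h3).resolve_left fun h =>
          hp ((Nat.prime_dvd_prime_iff_eq hpp Nat.prime_two).1 h)
        have hodd : Odd p := hpp.odd_of_ne_two hp
        have hle := Nat.le_of_dvd hj h4
        have h5 : p ∣ (2 * j - 1).doubleFactorial := by
          have : ∀ m, Odd m → p ≤ m → p ∣ m.doubleFactorial := by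
            intro m
            induction m using Nat.strong_induction_on with
            | _ m ih =>
              intro hm hle
              rcases hle.eq_or_lt with rfl | hlt
              · obtain ⟨q, hq⟩ : ∃ q, p = q + 1 := ⟨p - 1, by have := hpp.pos; omega⟩
                rcases q with _ | q
                · simp [hq]
                · rw [hq, Nat.doubleFactorial_add_two]
                  exact dvd_mul_right _ _
              · obtain ⟨q, rfl⟩ : ∃ q, m = q + 2 := ⟨m - 2, by have := hpp.two_le; omega⟩
                rw [Nat.doubleFactorial_add_two]
                exact (ih q (by omega) (by grind) (by grind)).mul_left _
          exact this _ (by grind) (by omega)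
        exact ((Int.natCast_dvd_natCast.2 h5).mul_left _).mul_right _
      · exact (Int.natCast_dvd_natCast.2 h3).mul_left _
    · rw [coeff_hermite_of_odd_add ho]
      exact dvd_zero _
  have hstep : (X : (ZMod p)[X]) ^ N ∣ (He (N + 1)).map (Int.castRingHom (ZMod p)) := by
    cases N with
    | zero => simp
    | succ M =>
      rw [show He (M + 1 + 1) = X * He (M + 1) - C ((M : ℤ) + 1) * He M from rfl]
      have : ((M : ZMod p) + 1) = 0 := by
        exact_mod_cast (ZMod.natCast_eq_zero_iff (M + 1) p).2 hN
      have h0 : (X * He (M + 1) - C ((M : ℤ) + 1) * He M).map (Int.castRingHom (ZMod p)) =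
          X * (He (M + 1)).map (Int.castRingHom (ZMod p)) := by
        rw [Polynomial.map_sub, Polynomial.map_mul, Polynomial.map_mul, map_X, map_C]
        simp [this]
      rw [h0]
      exact hbase.mul_left _
  have hall : ∀ r, (X : (ZMod p)[X]) ^ N ∣ (He (N + r)).map (Int.castRingHom (ZMod p)) ∧
      (X : (ZMod p)[X]) ^ N ∣ (He (N + r + 1)).map (Int.castRingHom (ZMod p)) := by
    intro r
    induction r with
    | zero => exact ⟨hbase, hstep⟩
    | succ r ih =>
      refine ⟨ih.2, ?_⟩
      rw [show He (N + (r + 1) + 1) =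
        X * He (N + r + 1) - C (((N + r : ℕ) : ℤ) + 1) * He (N + r) from rfl,
        Polynomial.map_sub, Polynomial.map_mul, Polynomial.map_mul]
      exact dvd_sub (ih.2.mul_left _) (ih.1.mul_left _)
  obtain ⟨r, rfl⟩ := Nat.exists_eq_add_of_le hn
  exact (hall r).1

theorem X_pow_dvd_map_wronskConsecutive {p N : ℕ} [Fact p.Prime] (hp : p ≠ 2) (hN : p ∣ N)
    (n : ℕ) (hn : N ≤ n) :
    (X : (ZMod p)[X]) ^ (2 * N) ∣ (wronskConsecutive n).map (Int.castRingHom (ZMod p)) := by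
  have h1 := X_pow_dvd_map_He hp hN n hn
  have h2 := X_pow_dvd_map_He hp hN (n + 1) (by omega)
  have h3 : wronskConsecutive n =
      He n * (C ((n : ℤ) + 1) * He n) - (X * He n - He (n + 1)) * He (n + 1) := by
    rw [wronskConsecutive, (He_succ_eq_sub_derivative n).2]
    linear_combination -He (n + 1) * (He_succ_eq_sub_derivative n).1
  rw [h3, two_mul, pow_add]
  simp only [Polynomial.map_sub, Polynomial.map_mul]
  exact dvd_sub (mul_dvd_mul h1 (h1.mul_left _)) (mul_dvd_mul (dvd_sub (h1.mul_left _) h2) h2)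

theorem dvd_coeff_zero_of_dvd_wronskConsecutive {p r n : ℕ} [Fact p.Prime] (hp : p ≠ 2)
    (hrn : r ≤ n) (hN : p ∣ n - r) {g : ℤ[X]} (hg : g ∣ wronskConsecutive n)
    (hd : 2 * r < g.natDegree) : (p : ℤ) ∣ g.coeff 0 := by
  by_contra hcon
  obtain ⟨hmon, hdeg⟩ := wronskConsecutive_monic n
  set φ := Int.castRingHom (ZMod p) with hφ
  obtain ⟨q, hq⟩ := X_pow_dvd_map_wronskConsecutive hp hN n (Nat.sub_le n r)
  have hg0 : (g.map φ).coeff 0 ≠ 0 := by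
    rw [coeff_map, hφ, eq_intCast, Ne, ZMod.intCast_zmod_eq_zero_iff_dvd]
    exact hcon
  have hdvd : g.map φ ∣ X ^ (2 * (n - r)) * q := hq ▸ Polynomial.map_dvd φ hg
  have hcop : IsCoprime (g.map φ) (X ^ (2 * (n - r))) := by
    apply IsCoprime.pow_right
    refine ((irreducible_X (R := ZMod p)).coprime_iff_not_dvd.2 ?_).symm
    rwa [X_dvd_iff]
  have hmonφ := hmon.map φ
  have hq0 : q ≠ 0 := by
    rintro rfl
    rw [mul_zero] at hq
    exact hmonφ.ne_zero hq
  have hle := natDegree_le_of_dvd (hcop.dvd_of_dvd_mul_left hdvd) hq0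
  have hqdeg := congrArg natDegree hq
  rw [hmon.natDegree_map, hdeg, natDegree_mul (pow_ne_zero _ X_ne_zero) hq0, natDegree_X_pow]
    at hqdeg
  have hunit : IsUnit g.leadingCoeff := by
    obtain ⟨h, hh⟩ := hg
    have := congrArg leadingCoeff hh
    rw [hmon.leadingCoeff, leadingCoeff_mul] at this
    exact IsUnit.of_mul_eq_one _ this.symm
  have hgdeg : (g.map φ).natDegree = g.natDegree :=
    natDegree_map_of_leadingCoeff_ne_zero _ (hunit.map φ).ne_zero
  omega

/-- The last index at which the weight `s * v_p(a_i) + i` is minimal. -/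
theorem exists_last_min_weight (p s : ℕ) {g : ℤ[X]} (hg : g ≠ 0) :
    ∃ J ∈ g.support, ∀ i ∈ g.support,
      s * padicValInt p (g.coeff J) + J ≤ s * padicValInt p (g.coeff i) + i ∧
      (J < i → s * padicValInt p (g.coeff J) + J < s * padicValInt p (g.coeff i) + i) := by
  set w : ℕ → ℕ := fun i => s * padicValInt p (g.coeff i) + i with hw
  obtain ⟨I, hI, hmin⟩ := g.support.exists_min_image w (support_nonempty.2 hg)
  obtain ⟨J, hJ, hmax⟩ := (g.support.filter fun i => w i = w I).exists_max_image id
    ⟨I, by simpa using hI⟩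
  rw [Finset.mem_filter] at hJ
  refine ⟨J, hJ.1, fun i hi => ?_⟩
  have h1 : w J ≤ w i := hJ.2 ▸ hmin i hi
  refine ⟨h1, fun hlt => lt_of_le_of_ne h1 fun heq => ?_⟩
  have := hmax i (Finset.mem_filter.2 ⟨hi, (show w i = w J from heq.symm).trans hJ.2⟩)
  simp only [id] at this
  omega

theorem not_dvd_coeff_zero_of_mul {p : ℕ} [Fact p.Prime] {g h : ℤ[X]}
    (h0 : (g * h).coeff 0 ≠ 0)
    (hf : ∀ k : ℕ, (g * h).coeff 0 ∣ (k.factorial : ℤ) * (g * h).coeff k)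
    (hlead : IsUnit g.leadingCoeff) (hpos : 0 < g.natDegree) (hdeg : g.natDegree ≤ p - 1) :
    ¬ (p : ℤ) ∣ g.coeff 0 := by
  have hpp : p.Prime := Fact.out
  have hp2 := hpp.two_le
  rw [mul_coeff_zero] at h0
  have hg0 := left_ne_zero_of_mul h0
  have hh0 := right_ne_zero_of_mul h0
  have hg : g ≠ 0 := by rintro rfl; simp at hg0
  have hh : h ≠ 0 := by rintro rfl; simp at hh0
  obtain ⟨J, hJ, hJmin⟩ := exists_last_min_weight p (p - 1) hg
  obtain ⟨K, hK, hKmin⟩ := exists_last_min_weight p (p - 1) hh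
  have hgJ := mem_support_iff.1 hJ
  have hhK := mem_support_iff.1 hK
  set v := padicValInt p (g.coeff J) + padicValInt p (h.coeff K) with hv
  have hterm : ¬ (p : ℤ) ^ (v + 1) ∣ g.coeff J * h.coeff K := by
    rw [padicValInt_dvd_iff, padicValInt.mul hgJ hhK]
    have := mul_ne_zero hgJ hhK
    grind
  have hrest : (p : ℤ) ^ (v + 1) ∣ (g * h).coeff (J + K) - g.coeff J * h.coeff K := by
    rw [coeff_mul, ← Finset.add_sum_erase _ _ (show (J, K) ∈ _ by simp),
      add_sub_cancel_left]
    refine Finset.dvd_sum fun x hx => ?_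
    obtain ⟨i, j⟩ := x
    rw [Finset.mem_erase, HasAntidiagonal.mem_antidiagonal] at hx
    obtain ⟨hne, hij⟩ := hx
    simp only at hij ⊢
    by_cases hgi : g.coeff i = 0
    · simp [hgi]
    by_cases hhj : h.coeff j = 0
    · simp [hhj]
    rw [padicValInt_dvd_iff, padicValInt.mul hgi hhj]
    right
    have a1 := hJmin i (mem_support_iff.2 hgi)
    have a2 := hKmin j (mem_support_iff.2 hhj)
    have hne' : i ≠ J := by
      rintro rfl
      exact hne (by simp; omega)
    have hlt : (p - 1) * v < (p - 1) * (padicValInt p (g.coeff i) + padicValInt p (h.coeff j)) := by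
      rw [hv, mul_add, mul_add]
      rcases lt_or_gt_of_ne hne' with hlt | hlt
      · have := a2.2 (by omega)
        omega
      · have := a1.2 hlt
        omega
    exact Nat.lt_of_mul_lt_mul_left hlt
  have hfJK : ¬ (p : ℤ) ^ (v + 1) ∣ (g * h).coeff (J + K) := fun hc =>
    hterm ((dvd_sub_right hc).1 hrest)
  have hfJK0 : (g * h).coeff (J + K) ≠ 0 := fun hc => hfJK (hc ▸ dvd_zero _)
  have hvf : padicValInt p ((g * h).coeff (J + K)) ≤ v := by
    rw [padicValInt_dvd_iff] at hfJK
    push Not at hfJK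
    omega
  have hval : padicValInt p (g.coeff 0) + padicValInt p (h.coeff 0) ≤
      padicValNat p (J + K).factorial + padicValInt p ((g * h).coeff (J + K)) := by
    have hd := hf (J + K)
    have hfac : (((J + K).factorial : ℕ) : ℤ) ≠ 0 := by exact_mod_cast (J + K).factorial_ne_zero
    rw [← padicValInt.mul hg0 hh0, ← padicValInt.of_nat, ← padicValInt.mul hfac hfJK0]
    have h2 := (padicValInt_dvd (p := p) (g.coeff 0 * h.coeff 0)).trans (mul_coeff_zero g h ▸ hd)
    rw [padicValInt_dvd_iff] at h2
    exact h2.resolve_left (mul_ne_zero hfac hfJK0)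
  have hJK : J + K = 0 := by
    by_contra hne
    have hfacval := sub_one_mul_padicValNat_factorial_lt_of_ne_zero p hne
    have b1 := (hJmin 0 (mem_support_iff.2 hg0)).1
    have b2 := (hKmin 0 (mem_support_iff.2 hh0)).1
    have b3 := Nat.mul_le_mul_left (p - 1) hval
    have b4 := Nat.mul_le_mul_left (p - 1) hvf
    rw [hv] at b4
    simp only [mul_add] at b3 b4
    omega
  have hJ0 : J = 0 := by omega
  subst hJ0
  have hlast := (hJmin g.natDegree (natDegree_mem_support_of_nonzero hg)).2 hpos
  have hl0 : padicValInt p (g.coeff g.natDegree) = 0 := by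
    rw [coeff_natDegree, padicValInt, Int.isUnit_iff_natAbs_eq.1 hlead, padicValNat_one_right]
  rw [hl0] at hlast
  intro hdvd
  have h1 : 1 ≤ padicValInt p (g.coeff 0) := by
    have := (padicValInt_dvd_iff (p := p) 1 (g.coeff 0)).1 (by simpa using hdvd)
    exact this.resolve_left hg0
  have := Nat.mul_le_mul_left (p - 1) h1
  omega

theorem natDegree_le_or_le_of_dvd_wronskConsecutive {p r n : ℕ} (hpp : p.Prime) (hp : p ≠ 2)
    (hrn : r ≤ n) (hN : p ∣ n - r) (h0 : (wronskConsecutive n).coeff 0 ≠ 0) {g : ℤ[X]}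
    (hg : g ∣ wronskConsecutive n) (hpos : 0 < g.natDegree) :
    g.natDegree ≤ 2 * r ∨ p ≤ g.natDegree := by
  have : Fact p.Prime := ⟨hpp⟩
  by_contra! hcon
  have hdvd := dvd_coeff_zero_of_dvd_wronskConsecutive hp hrn hN hg hcon.1
  have hk := coeff_zero_dvd_factorial_mul_coeff_wronskConsecutive n
  have hmon := (wronskConsecutive_monic n).1
  obtain ⟨h, hh⟩ := hg
  rw [hh] at h0 hk
  have hunit : IsUnit g.leadingCoeff := by
    have := congrArg leadingCoeff hh
    rw [hmon.leadingCoeff, leadingCoeff_mul] at this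
    exact IsUnit.of_mul_eq_one _ this.symm
  exact not_dvd_coeff_zero_of_mul h0 hk hunit hpos (by omega) hdvd

theorem exists_odd_prime_dvd_of_add_one_eq_sq {n k : ℕ} (hn : 8 < n) (h : n + 1 = k ^ 2) :
    ∃ p, p.Prime ∧ p ≠ 2 ∧ p ∣ n := by
  by_contra! hcon
  have hpow : ∀ m, m ∣ n → ∃ i, m = 2 ^ i := fun m hm =>
    ⟨_, Nat.eq_prime_pow_of_unique_prime_dvd
      (fun h0 => by subst h0; simp at hm; omega)
      fun {q} hq hqm => by_contra fun hq2 => hcon q hq hq2 (hqm.trans hm)⟩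
  have hk : 3 < k := by nlinarith
  have hfac : n = (k - 1) * (k + 1) := by
    obtain ⟨j, rfl⟩ : ∃ j, k = j + 1 := ⟨k - 1, by omega⟩
    simp only [Nat.add_sub_cancel]
    nlinarith
  obtain ⟨a, ha⟩ := hpow (k - 1) ⟨_, hfac⟩
  obtain ⟨b, hb⟩ := hpow (k + 1) ⟨k - 1, by rw [hfac, mul_comm]⟩
  have ha2 : 2 ≤ a := by
    by_contra! hlt
    interval_cases a <;> omega
  have hb2 : 2 ≤ b := by
    by_contra! hlt
    interval_cases b <;> omega
  have h1 := pow_dvd_pow 2 ha2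
  have h2 := pow_dvd_pow 2 hb2
  omega

theorem exists_prime_dvd_sq_sub_two {m k : ℕ} (hm : 2 < m) (h : m + 2 = k ^ 2) :
    ∃ p, p.Prime ∧ 5 ≤ p ∧ p ∣ m := by
  by_contra! hcon
  have h4 : ¬ 4 ∣ m := fun hd => by
    have : (m + 2) % 4 = 2 := by omega
    rw [h, Nat.pow_mod] at this
    have := Nat.mod_lt k (show 0 < 4 by norm_num)
    interval_cases k % 4 <;> omega
  have h3 : ¬ 3 ∣ m := fun hd => by
    have : (m + 2) % 3 = 2 := by omega
    rw [h, Nat.pow_mod] at this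
    have := Nat.mod_lt k (show 0 < 3 by norm_num)
    interval_cases k % 3 <;> omega
  have hpow : m = 2 ^ m.primeFactorsList.length :=
    Nat.eq_prime_pow_of_unique_prime_dvd (by omega) fun {q} hq hqm => by
      have hlt : q < 5 := by
        by_contra! hle
        exact hcon q hq hle hqm
      have := hq.two_le
      interval_cases q
      · rfl
      · exact absurd hqm h3
      · norm_num at hq
  generalize m.primeFactorsList.length = i at hpow
  have hi : 2 ≤ i := by
    by_contra! hlt
    interval_cases i <;> omega
  have := pow_dvd_pow 2 hi
  omega

theorem exists_prime_dvd_sq_sub_three {m k : ℕ} (hm : 6 < m) (h : m + 3 = k ^ 2) :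
    ∃ p, p.Prime ∧ 11 ≤ p ∧ p ∣ m := by
  have hmod : ∀ a, 0 < a → a ∣ m → k % a * (k % a) % a = 3 % a := by
    intro a ha ⟨c, hc⟩
    rw [← Nat.mul_mod, ← sq, ← h, hc]
    simp [Nat.add_mod]
  have hno : ∀ a, a = 4 ∨ a = 5 ∨ a = 7 ∨ a = 9 → ¬ a ∣ m := by
    intro a ha hd
    have h0 : 0 < a := by omega
    have h1 := hmod a h0 hd
    have h2 := Nat.mod_lt k h0
    rcases ha with rfl | rfl | rfl | rfl <;> generalize k % _ = x at * <;> interval_cases x <;> omega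
  have h6 : ∃ p, p.Prime ∧ p ≠ 2 ∧ p ≠ 3 ∧ p ∣ m := by
    by_contra! hcon
    obtain ⟨e, c, hc, hm2⟩ := Nat.exists_eq_pow_mul_and_not_dvd (n := m) (by omega) 2 (by norm_num)
    have hc0 : c ≠ 0 := by rintro rfl; simp at hc
    have hpow : c = 3 ^ c.primeFactorsList.length :=
      Nat.eq_prime_pow_of_unique_prime_dvd hc0 fun {q} hq hqc => by
        by_contra hq3
        exact hcon q hq (by rintro rfl; exact hc hqc) hq3 (hm2 ▸ hqc.mul_left _)
    generalize c.primeFactorsList.length = i at hpow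
    have he : e < 2 := by
      by_contra! hle
      exact hno 4 (by omega) (hm2 ▸ (pow_dvd_pow 2 hle).mul_right _)
    have hi : i < 2 := by
      by_contra! hle
      exact hno 9 (by omega) (hm2 ▸ (hpow ▸ pow_dvd_pow 3 hle).mul_left _)
    interval_cases e <;> interval_cases i <;> omega
  obtain ⟨p, hp, hp2, hp3, hpm⟩ := h6
  refine ⟨p, hp, ?_, hpm⟩
  by_contra! hlt
  have := hp.two_le
  have h5 := hno 5 (by omega)
  have h7 := hno 7 (by omega)
  interval_cases p <;> first | omega | (norm_num at hp)

theorem wronskHe_degSeq_eq (n : ℕ) : wronskHe (degSeq ![n, n]) = wronskConsecutive n := by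
  simp [wronskHe, degSeq, Matrix.det_fin_two, wronskConsecutive]
  ring

theorem vand_degSeq_eq (n : ℕ) : vand (degSeq ![n, n]) = 1 := by
  have h0 : (Finset.Iio (0 : Fin 2)) = ∅ := by decide
  have h1 : (Finset.Iio (1 : Fin 2)) = {0} := by decide
  simp [vand, degSeq, Fin.prod_univ_two, h0, h1]

theorem sStat_degSeq_eq (n : ℕ) : sStat (degSeq ![n, n]) = 0 := by
  have h : dStat (degSeq ![n, n]) = 0 := by
    simp only [dStat, Finset.card_filter, Fin.sum_univ_two]
    rcases Nat.even_or_odd n with h | h <;>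
      simp [degSeq, h, Nat.even_add_one, Nat.odd_add_one]
  simp [sStat, h]

/-- Lemma `lem:nn_up_to_10`.  Let `n ≥ 1000` with `n + 1` a perfect
square.  Then `R_{n,n}` has no factor in `ℤ[X]` of degree `d` for any `1 ≤ d ≤ 10`. -/
theorem stmt13 (n : ℕ) (hn : 1000 ≤ n) (hsq : ∃ k : ℕ, n + 1 = k ^ 2)
    (HeL RL : Polynomial ℤ)
    (hHe : Polynomial.C (vand (degSeq ![n, n])) * HeL = wronskHe (degSeq ![n, n]))
    (hR : HeL = Polynomial.X ^ sStat (degSeq ![n, n]) * RL)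
    (hR0 : RL.coeff 0 ≠ 0) :
    ∀ d : ℕ, 1 ≤ d → d ≤ 10 →
      ¬ ∃ g : Polynomial ℤ, g.natDegree = d ∧ g ∣ RL := by
  rw [vand_degSeq_eq, map_one, one_mul, wronskHe_degSeq_eq] at hHe
  rw [sStat_degSeq_eq, pow_zero, one_mul, hHe] at hR
  subst hR
  rintro d hd1 hd10 ⟨g, rfl, hg⟩
  obtain ⟨k, hk⟩ := hsq
  rcases le_or_gt g.natDegree 2 with h2 | h2
  · obtain ⟨p, hp, hp2, hpn⟩ := exists_odd_prime_dvd_of_add_one_eq_sq (by omega) hk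
    have := hp.two_le
    have := natDegree_le_or_le_of_dvd_wronskConsecutive hp hp2 (Nat.zero_le n) hpn hR0 hg hd1
    omega
  rcases le_or_gt g.natDegree 4 with h4 | h4
  · obtain ⟨p, hp, hp5, hpn⟩ := exists_prime_dvd_sq_sub_two (m := n - 1) (k := k)
      (by omega) (by omega)
    have := natDegree_le_or_le_of_dvd_wronskConsecutive hp (by omega) (by omega : 1 ≤ n) hpn hR0
      hg hd1
    omega
  · obtain ⟨p, hp, hp11, hpn⟩ := exists_prime_dvd_sq_sub_three (m := n - 2) (k := k)
      (by omega) (by omega)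
    have := natDegree_le_or_le_of_dvd_wronskConsecutive hp (by omega) (by omega : 2 ≤ n) hpn hR0
      hg hd1
    omega
end
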